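/- If M and N are indecomposable preprojective k(Γ,Λ)-modules, then the following are equivalent: (i) M ≅ N; (ii) S_M ∼ S_N; (iii) w(S_M) = w(S_N) in the Weyl group W. -/

import Mathlib

namespace KP

/-! ## Quivers on a fixed vertex set `Fin n`.

An orientation is encoded by `Λ : Fin n → Fin n → ℕ`, where `Λ a b` is the number of
arrows from `a` to `b`.  The underlying graph is recorded by `edges Λ a b = Λ a b + Λ b a`. -/

/-- The orientation `σ_x Λ` obtained by reversing every arrow incident with `x`. -/
def flipO {n : ℕ} (x : Fin n) (Λ : Fin n → Fin n → ℕ) : Fin n → Fin n → ℕ :=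
  fun a b => if a = x ∨ b = x then Λ b a else Λ a b

/-- Number of edges of the underlying graph joining `a` and `b`. -/
def edges {n : ℕ} (Λ : Fin n → Fin n → ℕ) (a b : Fin n) : ℕ := Λ a b + Λ b a

/-- `x` is a sink: no arrow starts at `x`. -/
def IsSink {n : ℕ} (Λ : Fin n → Fin n → ℕ) (x : Fin n) : Prop := ∀ y, Λ x y = 0

/-- `S` is a `(+)`-admissible sequence of vertices on `(Γ, Λ)`. -/
def Admissible {n : ℕ} (Λ : Fin n → Fin n → ℕ) : List (Fin n) → Prop
  | [] => True
  | x :: xs => IsSink Λ x ∧ Admissible (flipO x Λ) xs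

/-- The orientation `Λ^S`. -/
def orientAfter {n : ℕ} (Λ : Fin n → Fin n → ℕ) : List (Fin n) → (Fin n → Fin n → ℕ)
  | [] => Λ
  | x :: xs => orientAfter (flipO x Λ) xs

/-- Elementary move: interchange two consecutive vertices not joined by an edge. -/
inductive SwapRel {n : ℕ} (E : Fin n → Fin n → ℕ) : List (Fin n) → List (Fin n) → Prop
  | swap (l₁ l₂ : List (Fin n)) (a b : Fin n) (h : E a b = 0) :
      SwapRel E (l₁ ++ a :: b :: l₂) (l₁ ++ b :: a :: l₂)

/-- The equivalence `∼` on sequences of vertices: reflexive–transitive closure of the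
(symmetric) relation `SwapRel`. -/
def Sim {n : ℕ} (E : Fin n → Fin n → ℕ) : List (Fin n) → List (Fin n) → Prop :=
  Relation.ReflTransGen (SwapRel E)

/-- The preorder `S ⪯ T` : `T ∼ S ++ U` for some `(+)`-admissible sequence `U` on `(Γ, Λ^S)`. -/
def Preceq {n : ℕ} (Λ : Fin n → Fin n → ℕ) (S T : List (Fin n)) : Prop :=
  ∃ U, Admissible (orientAfter Λ S) U ∧ Sim (edges Λ) T (S ++ U)

/-- Support of a sequence of vertices. -/
def suppOf {n : ℕ} (S : List (Fin n)) : Set (Fin n) := {v | v ∈ S}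

/-- The partial order on vertices: `x ≤ y` iff there is a path from `x` to `y` in `(Γ, Λ)`. -/
def PathLE {n : ℕ} (Λ : Fin n → Fin n → ℕ) (x y : Fin n) : Prop :=
  Relation.ReflTransGen (fun a b => Λ a b ≠ 0) x y

/-- A filter (up-closed set) of the poset `(Γ₀, Λ)`. -/
def IsFilter {n : ℕ} (Λ : Fin n → Fin n → ℕ) (F : Set (Fin n)) : Prop :=
  ∀ x ∈ F, ∀ y, PathLE Λ x y → y ∈ F

/-- The principal filter `⟨x⟩`. -/
def upSet {n : ℕ} (Λ : Fin n → Fin n → ℕ) (x : Fin n) : Set (Fin n) := {y | PathLE Λ x y}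

/-- The hull `H_Λ(F)`: the smallest filter containing `F` and every vertex joined
by an edge to a vertex of `F`. -/
def hull {n : ℕ} (Λ : Fin n → Fin n → ℕ) (F : Set (Fin n)) : Set (Fin n) :=
  {y | ∃ x, (x ∈ F ∨ ∃ z ∈ F, edges Λ z x ≠ 0) ∧ PathLE Λ x y}

/-- `segs` is a canonical form of `S` (Proposition 2.1): `S ∼ S₁S₂⋯S_r`, each segment
consists of distinct vertices, is nonempty, and `Supp S_i = Supp (S_i S_{i+1} ⋯ S_r)`. -/
def Segments {n : ℕ} (Λ : Fin n → Fin n → ℕ) (S : List (Fin n))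
    (segs : List (List (Fin n))) : Prop :=
  Admissible Λ segs.flatten ∧ Sim (edges Λ) S segs.flatten ∧
  (∀ seg ∈ segs, seg ≠ [] ∧ seg.Nodup) ∧
  ∀ i, i < segs.length → suppOf (segs.getD i []) = suppOf ((segs.drop i).flatten)

/-- `J` is (a representative of) the join `S ∨ T` (Definition 2.4):  the canonical form of `J`
has `Supp R_i = Supp S_i ∪ Supp T_i` (out-of-range segments read as `∅`). -/
def IsJoin {n : ℕ} (Λ : Fin n → Fin n → ℕ) (S T J : List (Fin n)) : Prop :=
  ∃ CS CT CJ, Segments Λ S CS ∧ Segments Λ T CT ∧ Segments Λ J CJ ∧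
    ∀ i, suppOf (CJ.getD i []) = suppOf (CS.getD i []) ∪ suppOf (CT.getD i [])

/-- `M` is (a representative of) the meet `S ∧ T` (Definition 2.4). -/
def IsMeet {n : ℕ} (Λ : Fin n → Fin n → ℕ) (S T M : List (Fin n)) : Prop :=
  ∃ CS CT CM, Segments Λ S CS ∧ Segments Λ T CT ∧ Segments Λ M CM ∧
    ∀ i, suppOf (CM.getD i []) = suppOf (CS.getD i []) ∩ suppOf (CT.getD i [])

/-- `S` is (equivalent to) the join `T₁ ∨ ⋯ ∨ T_l` of the list of sequences `Ts`. -/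
def IsJoinList {n : ℕ} (Λ : Fin n → Fin n → ℕ) : List (List (Fin n)) → List (Fin n) → Prop
  | [], S => S = []
  | T :: Ts, S => ∃ J, IsJoinList Λ Ts J ∧ IsJoin Λ T J S

/-- The segments of a canonical form of a principal sequence `S_{r,x}` (Definition 3.1). -/
def PrincipalSegs {n : ℕ} (Λ : Fin n → Fin n → ℕ) (segs : List (List (Fin n)))
    (r : ℕ) (x : Fin n) : Prop :=
  segs.length = r ∧ 0 < r ∧
  (∀ i, i + 1 < r → suppOf (segs.getD i []) = hull Λ (suppOf (segs.getD (i+1) []))) ∧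
  suppOf (segs.getD (r-1) []) = upSet Λ x

/-- `S ∼ S_{r,x}`, the principal `(+)`-admissible sequence of size `r` with
`Supp S_r = ⟨x⟩`. -/
def IsPrincipalSeq {n : ℕ} (Λ : Fin n → Fin n → ℕ) (r : ℕ) (x : Fin n)
    (S : List (Fin n)) : Prop :=
  ∃ segs, Segments Λ S segs ∧ PrincipalSegs Λ segs r x

/-- `S` is a principal `(+)`-admissible sequence. -/
def IsPrincipal {n : ℕ} (Λ : Fin n → Fin n → ℕ) (S : List (Fin n)) : Prop :=
  ∃ r x, IsPrincipalSeq Λ r x S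


/-! ## Representations of `(Γ, Λ)` over a field `k`. -/

/-- A (finite-dimensional) representation of the quiver `(Γ, Λ)` over `k`:
the space at vertex `x` is `Fin (d x) → k`, and each arrow carries a linear map. -/
structure Rep (k : Type) [Field k] (n : ℕ) (Λ : Fin n → Fin n → ℕ) where
  d : Fin n → ℕ
  f : ∀ a b : Fin n, Fin (Λ a b) → ((Fin (d a) → k) →ₗ[k] (Fin (d b) → k))

variable {k : Type} [Field k] {n : ℕ}

/-- A morphism of representations. -/
structure RepHom {Λ : Fin n → Fin n → ℕ} (M N : Rep k n Λ) where
  g : ∀ x, (Fin (M.d x) → k) →ₗ[k] (Fin (N.d x) → k)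
  comm : ∀ a b i v, g b (M.f a b i v) = N.f a b i (g a v)

/-- Isomorphism of representations. -/
def RepIso {Λ : Fin n → Fin n → ℕ} (M N : Rep k n Λ) : Prop :=
  ∃ g : ∀ x, (Fin (M.d x) → k) ≃ₗ[k] (Fin (N.d x) → k),
    ∀ a b i v, g b (M.f a b i v) = N.f a b i (g a v)

/-- The zero representation. -/
def IsZeroRep {Λ : Fin n → Fin n → ℕ} (M : Rep k n Λ) : Prop := ∀ x, M.d x = 0

/-- Cast between the standard spaces. -/
def castL (k : Type) [Field k] {m m' : ℕ} (h : m = m') : (Fin m → k) ≃ₗ[k] (Fin m' → k) :=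
  LinearEquiv.funCongrLeft k k (finCongr h.symm)

/-- The splitting `(Fin (m + p) → k) ≃ₗ (Fin m → k) × (Fin p → k)`. -/
def splitL (k : Type) [Field k] (m p : ℕ) : (Fin (m + p) → k) ≃ₗ[k] (Fin m → k) × (Fin p → k) :=
  (LinearEquiv.funCongrLeft k k finSumFinEquiv).trans
    (LinearEquiv.sumArrowLequivProdArrow _ _ k k)

/-- Direct sum of two representations. -/
def dSum {Λ : Fin n → Fin n → ℕ} (M N : Rep k n Λ) : Rep k n Λ where
  d x := M.d x + N.d x
  f a b i :=
    (splitL k (M.d b) (N.d b)).symm.toLinearMap ∘ₗ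
      (LinearMap.prodMap (M.f a b i) (N.f a b i)) ∘ₗ (splitL k (M.d a) (N.d a)).toLinearMap

/-- The zero representation (as an object). -/
def zeroRep (k : Type) [Field k] (n : ℕ) (Λ : Fin n → Fin n → ℕ) : Rep k n Λ where
  d _ := 0
  f _ _ _ := 0

/-- Direct sum of a list of representations. -/
def dSumList {Λ : Fin n → Fin n → ℕ} (L : List (Rep k n Λ)) : Rep k n Λ :=
  L.foldr dSum (zeroRep k n Λ)

/-- `M` is indecomposable. -/
def Indecomp {Λ : Fin n → Fin n → ℕ} (M : Rep k n Λ) : Prop :=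
  ¬ IsZeroRep M ∧ ∀ A B : Rep k n Λ, RepIso M (dSum A B) → IsZeroRep A ∨ IsZeroRep B

/-- `X` is a direct summand of `M`. -/
def IsSummand {Λ : Fin n → Fin n → ℕ} (X M : Rep k n Λ) : Prop :=
  ∃ Y, RepIso M (dSum X Y)

/-! ### Reflection functors (on objects) -/

/-- Index type of the arrows ending at `x`. -/
abbrev Arin {n : ℕ} (Λ : Fin n → Fin n → ℕ) (x : Fin n) := Σ y : Fin n, Fin (Λ y x)

/-- Index type of the arrows starting at `x`. -/
abbrev Aout {n : ℕ} (Λ : Fin n → Fin n → ℕ) (x : Fin n) := Σ y : Fin n, Fin (Λ x y)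

/-- The map `h : ⊕_{a : y → x} V(y) → V(x)` induced by the maps along the arrows ending at `x`. -/
noncomputable def inMap (Λ : Fin n → Fin n → ℕ) (M : Rep k n Λ) (x : Fin n) :
    ((p : Arin Λ x) → (Fin (M.d p.1) → k)) →ₗ[k] (Fin (M.d x) → k) :=
  ∑ p : Arin Λ x, (M.f p.1 x p.2) ∘ₗ LinearMap.proj p

/-- The map `h' : V(x) → ⊕_{a : x → y} V(y)` induced by the maps along arrows starting at `x`. -/
def outMap (Λ : Fin n → Fin n → ℕ) (M : Rep k n Λ) (x : Fin n) :
    (Fin (M.d x) → k) →ₗ[k] ((p : Aout Λ x) → (Fin (M.d p.1) → k)) :=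
  LinearMap.pi fun p => M.f x p.1 p.2

noncomputable def kerEquiv (Λ : Fin n → Fin n → ℕ) (M : Rep k n Λ) (x : Fin n) :
    LinearMap.ker (inMap Λ M x) ≃ₗ[k]
      (Fin (Module.finrank k (LinearMap.ker (inMap Λ M x))) → k) :=
  (Module.finBasis k _).equivFun

noncomputable def cokerEquiv (Λ : Fin n → Fin n → ℕ) (M : Rep k n Λ) (x : Fin n) :
    (((p : Aout Λ x) → (Fin (M.d p.1) → k)) ⧸ LinearMap.range (outMap Λ M x)) ≃ₗ[k]
      (Fin (Module.finrank k (((p : Aout Λ x) → (Fin (M.d p.1) → k)) ⧸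
        LinearMap.range (outMap Λ M x))) → k) :=
  (Module.finBasis k _).equivFun

/-- The positive reflection functor `F_x⁺` (on objects): the space at `x` is replaced
by the kernel of `inMap`, with the maps along the reversed arrows induced by inclusion
followed by the projections. -/
noncomputable def reflPlus (x : Fin n) (Λ : Fin n → Fin n → ℕ) (M : Rep k n Λ) :
    Rep k n (flipO x Λ) where
  d z := if z = x then Module.finrank k (LinearMap.ker (inMap Λ M x)) else M.d z
  f a b i :=
    if ha : a = x then
      if hb : b = x then 0
      else
        (castL k (if_neg hb).symm).toLinearMap ∘ₗ
          (LinearMap.proj (φ := fun p : Arin Λ x => Fin (M.d p.1) → k)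
            (⟨b, Fin.cast (by subst ha; simp [flipO]) i⟩ : Arin Λ x)) ∘ₗ
          (LinearMap.ker (inMap Λ M x)).subtype ∘ₗ
          (kerEquiv Λ M x).symm.toLinearMap ∘ₗ (castL k (if_pos ha)).toLinearMap
    else
      if hb : b = x then 0
      else
        (castL k (if_neg hb).symm).toLinearMap ∘ₗ
          M.f a b (Fin.cast (by simp [flipO, ha, hb]) i) ∘ₗ
          (castL k (if_neg ha)).toLinearMap

/-- The negative reflection functor `F_x⁻` (on objects), presented as a map from
representations of `(Γ, σ_x Λ)` to representations of `(Γ, Λ)`: the space at `x` is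
replaced by the cokernel of `outMap`. -/
noncomputable def reflMinus (x : Fin n) (Λ : Fin n → Fin n → ℕ)
    (N : Rep k n (flipO x Λ)) : Rep k n Λ where
  d z := if z = x then
      Module.finrank k (((p : Aout (flipO x Λ) x) → (Fin (N.d p.1) → k)) ⧸
        LinearMap.range (outMap (flipO x Λ) N x))
    else N.d z
  f a b i :=
    if hb : b = x then
      if ha : a = x then 0
      else
        (castL k (if_pos hb).symm).toLinearMap ∘ₗ
          (cokerEquiv (flipO x Λ) N x).toLinearMap ∘ₗ
          (LinearMap.range (outMap (flipO x Λ) N x)).mkQ ∘ₗ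
          (LinearMap.single k (fun p : Aout (flipO x Λ) x => Fin (N.d p.1) → k)
            (⟨a, Fin.cast (by subst hb; simp [flipO]) i⟩ : Aout (flipO x Λ) x)) ∘ₗ
          (castL k (if_neg ha)).toLinearMap
    else
      if ha : a = x then 0
      else
        (castL k (if_neg hb).symm).toLinearMap ∘ₗ
          N.f a b (Fin.cast (by simp [flipO, ha, hb]) i) ∘ₗ
          (castL k (if_neg ha)).toLinearMap

/-- `F(S) = F_{x_s}⁺ ⋯ F_{x_1}⁺` applied to a representation. -/
noncomputable def FList : (S : List (Fin n)) → (Λ : Fin n → Fin n → ℕ) → Rep k n Λ →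
    Rep k n (orientAfter Λ S)
  | [], _, M => M
  | x :: xs, Λ, M => FList xs (flipO x Λ) (reflPlus x Λ M)

/-- `S` annihilates `M` : `F(S) M = 0`. -/
def Annihilates (Λ : Fin n → Fin n → ℕ) (S : List (Fin n)) (M : Rep k n Λ) : Prop :=
  IsZeroRep (FList S Λ M)

/-- `M` is preprojective: some `(+)`-admissible sequence annihilates it. -/
def Preprojective (Λ : Fin n → Fin n → ℕ) (M : Rep k n Λ) : Prop :=
  ∃ S, Admissible Λ S ∧ Annihilates Λ S M

/-- `S` is a shortest `(+)`-admissible sequence annihilating `M` : it annihilates `M` and no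
proper subsequence of `S` annihilates `M`.  (This predicate is invariant under `∼`, so it
expresses `S ∼ S_M`.) -/
def IsShortestAnn (Λ : Fin n → Fin n → ℕ) (M : Rep k n Λ) (S : List (Fin n)) : Prop :=
  Admissible Λ S ∧ Annihilates Λ S M ∧
  ∀ S', Admissible Λ S' → Annihilates Λ S' M → Preceq Λ S' S → Sim (edges Λ) S' S

/-- The simple representation `L_x` concentrated at the vertex `x`. -/
def simpleRep (Λ : Fin n → Fin n → ℕ) (x : Fin n) : Rep k n Λ where
  d z := if z = x then 1 else 0
  f _ _ _ := 0

/-- `M(S) = F_{x₁}⁻ F_{x₂}⁻ ⋯ F_{x_{s-1}}⁻ (L_{x_s})`, where `L_{x_s}` is the simple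
(projective) module over `k(Γ, σ_{x_{s-1}} ⋯ σ_{x_1} Λ)` at the vertex `x_s`. -/
noncomputable def Mof : (Λ : Fin n → Fin n → ℕ) → (S : List (Fin n)) → Rep k n Λ
  | Λ, [] => zeroRep k n Λ
  | Λ, [x] => simpleRep Λ x
  | Λ, x :: y :: ys => reflMinus x Λ (Mof (flipO x Λ) (y :: ys))

variable {n : ℕ}

/-! ## The Weyl group -/

/-- The simple reflection `σ_i` attached to a generalized Cartan matrix `A`,
as a linear endomorphism of `ℤⁿ` : `σ_i(v) = v - (∑ l, a_{il} v_l) e_i`. -/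
def sigmaL (A : Fin n → Fin n → ℤ) (i : Fin n) : (Fin n → ℤ) →ₗ[ℤ] (Fin n → ℤ) where
  toFun v := v - (∑ l, A i l * v l) • Pi.single i 1
  map_add' v w := by
    simp only [Pi.add_apply, mul_add, Finset.sum_add_distrib, add_smul]
    abel
  map_smul' c v := by
    simp only [Pi.smul_apply, smul_eq_mul, RingHom.id_apply, smul_sub]
    congr 1
    rw [smul_smul, Finset.mul_sum]
    congr 1
    exact Finset.sum_congr rfl fun l _ => by ring

theorem sigma_invol (A : Fin n → Fin n → ℤ) (hA : ∀ i, A i i = 2) (i : Fin n) :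
    (sigmaL A i).comp (sigmaL A i) = LinearMap.id := by
  apply LinearMap.ext
  intro v
  simp only [LinearMap.comp_apply, LinearMap.id_apply, sigmaL, LinearMap.coe_mk, AddHom.coe_mk]
  set c := ∑ l, A i l * v l with hc
  set s : Fin n → ℤ := Pi.single i 1 with hs
  have h1 : ∑ l, A i l * (v - c • s) l = -c := by
    have h2 : ∀ l, A i l * (v - c • s) l = A i l * v l - c * (A i l * s l) := fun l => by
      simp only [Pi.sub_apply, Pi.smul_apply, smul_eq_mul]
      ring
    rw [Finset.sum_congr rfl fun l _ => h2 l, Finset.sum_sub_distrib, ← Finset.mul_sum]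
    have h3 : ∑ l, A i l * s l = 2 := by
      rw [Finset.sum_eq_single i]
      · simp [hs, hA i]
      · intro b _ hb
        simp [hs, Pi.single_eq_of_ne hb]
      · simp
    rw [h3, ← hc]
    ring
  rw [h1]
  ext j
  simp only [Pi.sub_apply, Pi.smul_apply, smul_eq_mul]
  ring

/-- The simple reflection `σ_i` as an automorphism of `ℤⁿ`. -/
def sigmaE (A : Fin n → Fin n → ℤ) (hA : ∀ i, A i i = 2) (i : Fin n) :
    (Fin n → ℤ) ≃ₗ[ℤ] (Fin n → ℤ) :=
  LinearEquiv.ofLinear (sigmaL A i) (sigmaL A i) (sigma_invol A hA i) (sigma_invol A hA i)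

/-- The length `ℓ(w)`: the least `l ≥ 0` such that `w` is a product of `l` simple
reflections. -/
noncomputable def wordLen (A : Fin n → Fin n → ℤ) (hA : ∀ i, A i i = 2)
    (w : (Fin n → ℤ) ≃ₗ[ℤ] (Fin n → ℤ)) : ℕ :=
  sInf {l | ∃ ys : List (Fin n), ys.length = l ∧ w = (ys.map (sigmaE A hA)).prod}

/-- The word `w(S) = σ_{x_s} ⋯ σ_{x_1}` associated to a sequence `S = x₁, …, x_s`. -/
def wordOf (A : Fin n → Fin n → ℤ) (hA : ∀ i, A i i = 2) (S : List (Fin n)) :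
    (Fin n → ℤ) ≃ₗ[ℤ] (Fin n → ℤ) :=
  ((S.reverse).map (sigmaE A hA)).prod

/-- The symmetric generalized Cartan matrix of the underlying graph of `(Γ, Λ)`. -/
def cartanOf (Λ : Fin n → Fin n → ℕ) : Fin n → Fin n → ℤ :=
  fun i j => if i = j then 2 else -(edges Λ i j : ℤ)

theorem cartan_diag (Λ : Fin n → Fin n → ℕ) : ∀ i, cartanOf Λ i i = 2 := by
  intro i; simp [cartanOf]

/-- The simple reflections of the Weyl group of the underlying graph of `(Γ, Λ)`. -/
def wSig (Λ : Fin n → Fin n → ℕ) : Fin n → ((Fin n → ℤ) ≃ₗ[ℤ] (Fin n → ℤ)) :=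
  sigmaE (cartanOf Λ) (cartan_diag Λ)

/-- `w(S)` for a sequence of vertices of `(Γ, Λ)`. -/
def wordOfSeq (Λ : Fin n → Fin n → ℕ) (S : List (Fin n)) :
    (Fin n → ℤ) ≃ₗ[ℤ] (Fin n → ℤ) :=
  ((S.reverse).map (wSig Λ)).prod

/-- The word `w(S)` is reduced: `ℓ(w(S))` equals the number of letters of `S`. -/
noncomputable def IsReducedSeq (Λ : Fin n → Fin n → ℕ) (S : List (Fin n)) : Prop :=
  wordLen (cartanOf Λ) (cartan_diag Λ) (wordOfSeq Λ S) = S.length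

/-! ## Dynkin graphs of types A, D, E -/

def edgeA (n : ℕ) : Fin n → Fin n → ℕ := fun i j =>
  if (i : ℕ) + 1 = (j : ℕ) ∨ (j : ℕ) + 1 = (i : ℕ) then 1 else 0

def edgeD (n : ℕ) : Fin n → Fin n → ℕ := fun i j =>
  if ((i : ℕ) = 0 ∧ (j : ℕ) = 2) ∨ ((j : ℕ) = 0 ∧ (i : ℕ) = 2) ∨
     ((i : ℕ) = 1 ∧ (j : ℕ) = 2) ∨ ((j : ℕ) = 1 ∧ (i : ℕ) = 2) ∨
     (2 ≤ (i : ℕ) ∧ (i : ℕ) + 1 = (j : ℕ)) ∨ (2 ≤ (j : ℕ) ∧ (j : ℕ) + 1 = (i : ℕ))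
  then 1 else 0

def edgeE (n : ℕ) : Fin n → Fin n → ℕ := fun i j =>
  if ((i : ℕ) + 1 = (j : ℕ) ∧ (j : ℕ) ≤ n - 2) ∨ ((j : ℕ) + 1 = (i : ℕ) ∧ (i : ℕ) ≤ n - 2) ∨
     ((i : ℕ) = 2 ∧ (j : ℕ) = n - 1) ∨ ((j : ℕ) = 2 ∧ (i : ℕ) = n - 1)
  then 1 else 0

/-- The underlying graph (given by its edge-count function `E`) is a Dynkin diagram of
type `A`, `D`, or `E`. -/
def IsDynkinADE (n : ℕ) (E : Fin n → Fin n → ℕ) : Prop :=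
  ∃ e : Fin n ≃ Fin n,
    (∀ i j, E i j = edgeA n (e i) (e j)) ∨
    (4 ≤ n ∧ ∀ i j, E i j = edgeD n (e i) (e j)) ∨
    ((n = 6 ∨ n = 7 ∨ n = 8) ∧ ∀ i j, E i j = edgeE n (e i) (e j))

/-! ## Coxeter-sortable elements -/

/-- Lexicographic comparison of index tuples. -/
def lexLE {s : ℕ} (ι ι' : Fin s → ℕ) : Prop :=
  ι = ι' ∨ ∃ j, (∀ j', j' < j → ι j' = ι' j') ∧ ι j < ι' j

/-- `w` is `c`-sortable for the Coxeter element determined by the half-infinite word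
`cseq` (with dividers every `blockLen` letters): the lexicographically first subsequence
of `cseq` that is a reduced word for `w` defines a sequence of subsets (between adjacent
dividers) that is decreasing under inclusion. -/
def CSortable (A : Fin n → Fin n → ℤ) (hA : ∀ i, A i i = 2) (cseq : ℕ → Fin n)
    (blockLen : ℕ) (w : (Fin n → ℤ) ≃ₗ[ℤ] (Fin n → ℤ)) : Prop :=
  ∃ (s : ℕ) (ι : Fin s → ℕ), StrictMono ι ∧
    w = ((List.ofFn fun j => cseq (ι j)).map (sigmaE A hA)).prod ∧
    wordLen A hA w = s ∧
    (∀ ι' : Fin s → ℕ, StrictMono ι' →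
      w = ((List.ofFn fun j => cseq (ι' j)).map (sigmaE A hA)).prod → lexLE ι ι') ∧
    ∀ m : ℕ, {a : Fin n | ∃ j, (ι j) / blockLen = m + 1 ∧ cseq (ι j) = a} ⊆
             {a : Fin n | ∃ j, (ι j) / blockLen = m ∧ cseq (ι j) = a}


/-- A nonzero non-isomorphism between representations. -/
def RepStep {k : Type} [Field k] {n : ℕ} {Λ : Fin n → Fin n → ℕ} (X Y : Rep k n Λ) : Prop :=
  ∃ f : RepHom X Y, (∃ x v, f.g x v ≠ 0) ∧ ¬ ∀ x, Function.Bijective (f.g x)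

/-- `v` is a minimal element of `D` in the poset `(Γ₀, Λ)`. -/
def MinimalIn {n : ℕ} (Λ : Fin n → Fin n → ℕ) (D : Set (Fin n)) (v : Fin n) : Prop :=
  v ∈ D ∧ ∀ u ∈ D, PathLE Λ u v → u = v

/-- The pairs `(h, v)` of Proposition 3.2(a): `0 < h ≤ r` and `v` a minimal element of
`Supp S_h \ H_Λ(Supp S_{h+1})` (with `Supp S_{r+1} = ∅`). -/
def JoinPair {n : ℕ} (Λ : Fin n → Fin n → ℕ) (segs : List (List (Fin n)))
    (p : ℕ × Fin n) : Prop :=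
  0 < p.1 ∧ p.1 ≤ segs.length ∧
  MinimalIn Λ (suppOf (segs.getD (p.1 - 1) []) \ hull Λ (suppOf (segs.getD p.1 []))) p.2


section Combin

theorem flipO_loop {n : ℕ} (Λ : Fin n → Fin n → ℕ) (x : Fin n) (h : ∀ a, Λ a a = 0) :
    ∀ a, flipO x Λ a a = 0 := by
  intro a; simp [flipO, h]

theorem edges_flipO {n : ℕ} (Λ : Fin n → Fin n → ℕ) (x : Fin n) :
    edges (flipO x Λ) = edges Λ := by
  funext a b
  simp only [edges, flipO]
  by_cases ha : a = x <;> by_cases hb : b = x <;> simp [ha, hb, add_comm]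

theorem edges_symm {n : ℕ} (Λ : Fin n → Fin n → ℕ) (a b : Fin n) :
    edges Λ a b = edges Λ b a := by simp [edges, add_comm]

theorem wSig_flipO {n : ℕ} (Λ : Fin n → Fin n → ℕ) (x : Fin n) :
    wSig (flipO x Λ) = wSig Λ := by
  have h : cartanOf (flipO x Λ) = cartanOf Λ := by
    funext i j; simp [cartanOf, edges_flipO]
  funext i
  ext v : 1
  show sigmaL (cartanOf (flipO x Λ)) i v = sigmaL (cartanOf Λ) i v
  rw [h]

theorem wSig_apply {n : ℕ} (Λ : Fin n → Fin n → ℕ) (x : Fin n) (v : Fin n → ℤ) :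
    wSig Λ x v = v - (∑ l, cartanOf Λ x l * v l) • Pi.single x 1 := rfl

theorem wSig_apply_ne {n : ℕ} (Λ : Fin n → Fin n → ℕ) (x : Fin n) (v : Fin n → ℤ) {z : Fin n}
    (hz : z ≠ x) : wSig Λ x v z = v z := by
  rw [wSig_apply]; simp [hz]

theorem wSig_wSig {n : ℕ} (Λ : Fin n → Fin n → ℕ) (x : Fin n) (v : Fin n → ℤ) :
    wSig Λ x (wSig Λ x v) = v := by
  have := sigma_invol (cartanOf Λ) (cartan_diag Λ) x
  exact LinearMap.congr_fun this v

/-- If `v` vanishes at `x` and its neighbours then `σ_x v = v`. -/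
theorem wSig_fix {n : ℕ} (Λ : Fin n → Fin n → ℕ) (x : Fin n) (v : Fin n → ℤ)
    (h : ∀ l, l = x ∨ edges Λ x l ≠ 0 → v l = 0) : wSig Λ x v = v := by
  rw [wSig_apply]
  have : ∑ l, cartanOf Λ x l * v l = 0 := by
    apply Finset.sum_eq_zero
    intro l _
    by_cases hl : l = x
    · simp [h l (Or.inl hl)]
    · by_cases he : edges Λ x l = 0
      · simp [cartanOf, Ne.symm hl, he]
      · simp [h l (Or.inr he)]
  simp [this]

theorem wSig_single {n : ℕ} (Λ : Fin n → Fin n → ℕ) (x : Fin n) :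
    wSig Λ x (Pi.single x 1) = - Pi.single x 1 := by
  rw [wSig_apply]
  have : ∑ l, cartanOf Λ x l * (Pi.single x 1 : Fin n → ℤ) l = 2 := by
    rw [Finset.sum_eq_single x]
    · simp [cartan_diag]
    · intro b _ hb; simp [hb]
    · simp
  rw [this]
  ext z; simp; ring

theorem wSig_comm {n : ℕ} (Λ : Fin n → Fin n → ℕ) (a b : Fin n) (h : edges Λ a b = 0)
    (v : Fin n → ℤ) : wSig Λ a (wSig Λ b v) = wSig Λ b (wSig Λ a v) := by
  by_cases hab : a = b
  · rw [hab]
  have key : ∀ a b : Fin n, a ≠ b → edges Λ a b = 0 → ∀ (w : Fin n → ℤ) (c : ℤ),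
      ∑ l, cartanOf Λ a l * (w - c • (Pi.single b 1 : Fin n → ℤ)) l =
        ∑ l, cartanOf Λ a l * w l := by
    intro a b hab h w c
    apply Finset.sum_congr rfl
    intro l _
    by_cases hl : l = b
    · subst hl; simp [cartanOf, hab, h]
    · simp [hl]
  have h2 : edges Λ b a = 0 := by rw [edges_symm]; exact h
  rw [wSig_apply Λ a (wSig Λ b v), wSig_apply Λ b (wSig Λ a v), wSig_apply Λ a v,
    wSig_apply Λ b v, key a b hab h, key b a (Ne.symm hab) h2]
  abel

theorem wordOfSeq_cons {n : ℕ} (Λ : Fin n → Fin n → ℕ) (x : Fin n) (S : List (Fin n))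
    (v : Fin n → ℤ) : wordOfSeq Λ (x :: S) v = wordOfSeq Λ S (wSig Λ x v) := by
  simp [wordOfSeq, List.reverse_cons, List.map_append, List.prod_append]

theorem wordOfSeq_nil {n : ℕ} (Λ : Fin n → Fin n → ℕ) (v : Fin n → ℤ) :
    wordOfSeq Λ [] v = v := by
  simp [wordOfSeq]

theorem wordOfSeq_flipO {n : ℕ} (Λ : Fin n → Fin n → ℕ) (x : Fin n) (S : List (Fin n)) :
    wordOfSeq (flipO x Λ) S = wordOfSeq Λ S := by
  simp [wordOfSeq, wSig_flipO]

theorem wordOfSeq_append {n : ℕ} (Λ : Fin n → Fin n → ℕ) (S T : List (Fin n))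
    (v : Fin n → ℤ) : wordOfSeq Λ (S ++ T) v = wordOfSeq Λ T (wordOfSeq Λ S v) := by
  simp [wordOfSeq, List.map_append, List.prod_append]

theorem sim_word {n : ℕ} (Λ : Fin n → Fin n → ℕ) {S T : List (Fin n)}
    (h : Sim (edges Λ) S T) : wordOfSeq Λ S = wordOfSeq Λ T := by
  induction h with
  | refl => rfl
  | tail _ h ih =>
    rw [ih]
    obtain ⟨l₁, l₂, a, b, hab⟩ := h
    ext v : 1
    simp only [wordOfSeq_append, wordOfSeq_cons]
    rw [wSig_comm Λ a b hab]

/-! Sim -/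

theorem sim_refl {n : ℕ} (E : Fin n → Fin n → ℕ) (S : List (Fin n)) : Sim E S S :=
  Relation.ReflTransGen.refl

theorem sim_trans {n : ℕ} {E : Fin n → Fin n → ℕ} {S T U : List (Fin n)}
    (h : Sim E S T) (h' : Sim E T U) : Sim E S U := Relation.ReflTransGen.trans h h'

theorem sim_symm {n : ℕ} (Λ : Fin n → Fin n → ℕ) {S T : List (Fin n)}
    (h : Sim (edges Λ) S T) : Sim (edges Λ) T S := by
  induction h with
  | refl => exact sim_refl _ _
  | tail _ h ih =>
    obtain ⟨l₁, l₂, a, b, hab⟩ := h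
    refine sim_trans (Relation.ReflTransGen.single ?_) ih
    exact SwapRel.swap l₁ l₂ b a (by rw [edges_symm]; exact hab)

theorem sim_perm {n : ℕ} {E : Fin n → Fin n → ℕ} {S T : List (Fin n)}
    (h : Sim E S T) : S.Perm T := by
  induction h with
  | refl => exact List.Perm.refl _
  | tail _ h ih =>
    obtain ⟨l₁, l₂, a, b, hab⟩ := h
    exact ih.trans ((List.Perm.swap b a l₂).append_left l₁)

theorem sim_length {n : ℕ} {E : Fin n → Fin n → ℕ} {S T : List (Fin n)}
    (h : Sim E S T) : S.length = T.length := (sim_perm h).length_eq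

theorem sim_cons {n : ℕ} {E : Fin n → Fin n → ℕ} {S T : List (Fin n)} (x : Fin n)
    (h : Sim E S T) : Sim E (x :: S) (x :: T) := by
  induction h with
  | refl => exact sim_refl _ _
  | tail _ h ih =>
    obtain ⟨l₁, l₂, a, b, hab⟩ := h
    exact sim_trans ih (Relation.ReflTransGen.single (SwapRel.swap (x :: l₁) l₂ a b hab))

/-- A vertex not adjacent to any letter of `R` can be moved past `R`. -/
theorem sim_move {n : ℕ} {E : Fin n → Fin n → ℕ} (x : Fin n) (R U : List (Fin n))
    (h : ∀ r ∈ R, E x r = 0) : Sim E (x :: (R ++ U)) (R ++ x :: U) := by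
  induction R with
  | nil => exact sim_refl _ _
  | cons r R ih =>
    refine sim_trans (Relation.ReflTransGen.single
      (SwapRel.swap [] (R ++ U) x r (h r (by simp)))) ?_
    exact sim_cons r (ih (fun s hs => h s (by simp [hs])))

theorem adm_append {n : ℕ} (Λ : Fin n → Fin n → ℕ) (S T : List (Fin n)) :
    Admissible Λ (S ++ T) ↔ Admissible Λ S ∧ Admissible (orientAfter Λ S) T := by
  induction S generalizing Λ with
  | nil => simp [Admissible, orientAfter]
  | cons x S ih => simp [Admissible, orientAfter, ih, and_assoc]

theorem orient_append {n : ℕ} (Λ : Fin n → Fin n → ℕ) (S T : List (Fin n)) :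
    orientAfter Λ (S ++ T) = orientAfter (orientAfter Λ S) T := by
  induction S generalizing Λ with
  | nil => rfl
  | cons x S ih => exact ih _

theorem edges_orient {n : ℕ} (Λ : Fin n → Fin n → ℕ) (S : List (Fin n)) :
    edges (orientAfter Λ S) = edges Λ := by
  induction S generalizing Λ with
  | nil => rfl
  | cons x S ih => exact (ih _).trans (edges_flipO _ _)

theorem flipO_comm {n : ℕ} (Λ : Fin n → Fin n → ℕ) (a b : Fin n) (h : edges Λ a b = 0) :
    flipO a (flipO b Λ) = flipO b (flipO a Λ) := by
  simp only [edges, Nat.add_eq_zero_iff] at h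
  funext u v
  simp only [flipO]
  grind

theorem sink_flipO {n : ℕ} (Λ : Fin n → Fin n → ℕ) (a b : Fin n) (hab : a ≠ b)
    (h : edges Λ a b = 0) :
    IsSink (flipO a Λ) b ↔ IsSink Λ b := by
  simp only [edges, Nat.add_eq_zero_iff] at h
  simp only [IsSink, flipO]
  refine forall_congr' fun y => ?_
  grind

theorem adm_swap {n : ℕ} (Λ : Fin n → Fin n → ℕ) (a b : Fin n) (l : List (Fin n))
    (h : edges Λ a b = 0) (hA : Admissible Λ (a :: b :: l)) : Admissible Λ (b :: a :: l) := by
  by_cases hab : a = b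
  · subst hab; exact hA
  obtain ⟨h1, h2, h3⟩ := hA
  have h' : edges Λ b a = 0 := by rw [edges_symm]; exact h
  refine ⟨(sink_flipO Λ a b hab h).1 h2, (sink_flipO Λ b a (Ne.symm hab) h').2 h1, ?_⟩
  rw [flipO_comm Λ a b h]; exact h3

theorem sim_adm {n : ℕ} (Λ : Fin n → Fin n → ℕ) {S T : List (Fin n)}
    (h : Sim (edges Λ) S T) (hS : Admissible Λ S) : Admissible Λ T := by
  induction h with
  | refl => exact hS
  | tail _ h ih =>
    obtain ⟨l₁, l₂, a, b, hab⟩ := h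
    rw [adm_append] at ih ⊢
    exact ⟨ih.1, adm_swap _ a b l₂ (by rw [edges_orient]; exact hab) ih.2⟩

/-- If `x` is a sink and `x ∉ T`, then no letter of `T` is adjacent to `x`. -/
theorem adm_not_adj {n : ℕ} (Λ : Fin n → Fin n → ℕ) (x : Fin n) (T : List (Fin n))
    (hx : IsSink Λ x) (hT : Admissible Λ T) (hxT : x ∉ T) : ∀ t ∈ T, edges Λ x t = 0 := by
  induction T generalizing Λ with
  | nil => simp
  | cons y T ih =>
    simp only [List.mem_cons, not_or] at hxT
    obtain ⟨h1, h2⟩ := hT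
    have hxy : edges Λ x y = 0 := by simp [edges, hx y, h1 x]
    have hs : IsSink (flipO y Λ) x :=
      (sink_flipO Λ y x (Ne.symm hxT.1) (by rw [edges_symm]; exact hxy)).2 hx
    have := ih (flipO y Λ) hs h2 hxT.2
    rw [edges_flipO] at this
    intro t ht
    rcases List.mem_cons.1 ht with rfl | ht
    · exact hxy
    · exact this t ht

/-! Numerical annihilation -/

def NAnn {n : ℕ} (Λ : Fin n → Fin n → ℕ) : (Fin n → ℤ) → List (Fin n) → Prop
  | _, [] => False
  | d, x :: S => d = Pi.single x 1 ∨ (0 ≤ d ∧ NAnn Λ (wSig Λ x d) S)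

theorem single_nonneg' {n : ℕ} (x : Fin n) : (0 : Fin n → ℤ) ≤ Pi.single x 1 := by
  intro z
  by_cases h : z = x
  · subst h; simp
  · simp [h]

theorem nann_nonneg {n : ℕ} (Λ : Fin n → Fin n → ℕ) {d : Fin n → ℤ} {S : List (Fin n)}
    (h : NAnn Λ d S) : 0 ≤ d := by
  cases S with
  | nil => exact h.elim
  | cons x S =>
    rcases h with h | h
    · rw [h]; exact single_nonneg' x
    · exact h.1

theorem nann_flipO {n : ℕ} (Λ : Fin n → Fin n → ℕ) (x : Fin n) (d : Fin n → ℤ)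
    (S : List (Fin n)) : NAnn (flipO x Λ) d S ↔ NAnn Λ d S := by
  induction S generalizing d with
  | nil => rfl
  | cons y S ih => simp only [NAnn, wSig_flipO, ih]

theorem nann_supp {n : ℕ} (Λ : Fin n → Fin n → ℕ) {d : Fin n → ℤ} {S : List (Fin n)}
    (h : NAnn Λ d S) (z : Fin n) (hz : z ∉ S) : d z = 0 := by
  induction S generalizing d with
  | nil => exact h.elim
  | cons y S ih =>
    simp only [List.mem_cons, not_or] at hz
    rcases h with h | h
    · rw [h]; simp [hz.1]
    · have := ih h.2 hz.2
      rwa [wSig_apply_ne Λ y d hz.1] at this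

theorem nann_swap {n : ℕ} (Λ : Fin n → Fin n → ℕ) (a b : Fin n) (l : List (Fin n))
    (hE : edges Λ a b = 0) (d : Fin n → ℤ) (h : NAnn Λ d (a :: b :: l)) :
    NAnn Λ d (b :: a :: l) := by
  by_cases hab : a = b
  · subst hab; exact h
  have hE' : edges Λ b a = 0 := by rw [edges_symm]; exact hE
  have fix : ∀ a b : Fin n, a ≠ b → edges Λ a b = 0 →
      wSig Λ a (Pi.single b 1) = Pi.single b 1 := by
    intro a b hab h
    apply wSig_fix
    rintro l (rfl | hl)
    · simp [hab]
    · have : l ≠ b := by rintro rfl; exact hl h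
      simp [this]
  rcases h with h | ⟨h0, h | ⟨h1, h⟩⟩
  · right
    refine ⟨by rw [h]; exact single_nonneg' a, Or.inl ?_⟩
    rw [h, fix b a (Ne.symm hab) hE']
  · left
    rw [← wSig_wSig Λ a d, h, fix a b hab hE]
  · right
    refine ⟨h0, Or.inr ⟨?_, ?_⟩⟩
    · intro z
      by_cases hz : z = b
      · have h2 := nann_nonneg Λ h z
        rw [← wSig_comm Λ a b hE, wSig_apply_ne Λ a _ (by rw [hz]; exact Ne.symm hab)] at h2
        exact h2
      · rw [wSig_apply_ne Λ b _ hz]; exact h0 z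
    · rw [wSig_comm Λ a b hE]; exact h

theorem nann_prefix {n : ℕ} (Λ : Fin n → Fin n → ℕ) (l S T : List (Fin n))
    (H : ∀ d, NAnn Λ d S → NAnn Λ d T) (d : Fin n → ℤ) (h : NAnn Λ d (l ++ S)) :
    NAnn Λ d (l ++ T) := by
  induction l generalizing d with
  | nil => exact H d h
  | cons x l ih =>
    rcases h with h | h
    · exact Or.inl h
    · exact Or.inr ⟨h.1, ih _ h.2⟩

theorem sim_nann {n : ℕ} (Λ : Fin n → Fin n → ℕ) {S T : List (Fin n)}
    (h : Sim (edges Λ) S T) (d : Fin n → ℤ) (hS : NAnn Λ d S) : NAnn Λ d T := by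
  induction h with
  | refl => exact hS
  | tail _ h ih =>
    obtain ⟨l₁, l₂, a, b, hab⟩ := h
    exact nann_prefix Λ l₁ _ _ (nann_swap Λ a b l₂ hab) d ih

/-- Key lemma: two annihilating admissible sequences have a common annihilating initial part. -/
theorem key_common {n : ℕ} (Λ : Fin n → Fin n → ℕ) (S T : List (Fin n)) (d : Fin n → ℤ)
    (hS : Admissible Λ S) (hT : Admissible Λ T) (hdS : NAnn Λ d S) (hdT : NAnn Λ d T) :
    ∃ R, NAnn Λ d R ∧ (∃ U, Sim (edges Λ) S (R ++ U)) ∧ ∃ V, Sim (edges Λ) T (R ++ V) := by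
  induction S generalizing Λ T d with
  | nil => exact hdS.elim
  | cons x S ih =>
    by_cases hxT : x ∈ T
    · obtain ⟨T1, T2, hT12, hx1⟩ : ∃ T1 T2, T = T1 ++ x :: T2 ∧ x ∉ T1 := by
        obtain ⟨T1, T2, h, h'⟩ := List.mem_iff_append.1 hxT |>.elim fun s ⟨t, h⟩ =>
          List.eq_append_cons_of_mem hxT
        exact ⟨T1, T2, h, h'⟩
      have hadj := adm_not_adj Λ x T1 hS.1 ((adm_append Λ _ _).1 (hT12 ▸ hT)).1 hx1
      have hsim : Sim (edges Λ) (x :: (T1 ++ T2)) T := hT12 ▸ sim_move x T1 T2 hadj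
      have hT' := sim_adm Λ (sim_symm Λ hsim) hT
      have hdT' := sim_nann Λ (sim_symm Λ hsim) d hdT
      by_cases hd : d = Pi.single x 1
      · refine ⟨[x], Or.inl hd, ⟨S, sim_refl _ _⟩, ⟨T1 ++ T2, sim_symm Λ hsim⟩⟩
      · rcases hdS with h | ⟨h0, h1⟩
        · exact (hd h).elim
        rcases hdT' with h | ⟨_, h2⟩
        · exact (hd h).elim
        obtain ⟨R, hR, ⟨U, hU⟩, ⟨V, hV⟩⟩ := ih (flipO x Λ) (T1 ++ T2) (wSig Λ x d) hS.2 hT'.2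
          ((nann_flipO _ _ _ _).2 h1) ((nann_flipO _ _ _ _).2 h2)
        rw [nann_flipO] at hR
        rw [edges_flipO] at hU hV
        exact ⟨x :: R, Or.inr ⟨h0, hR⟩, ⟨U, sim_cons x hU⟩,
          ⟨V, sim_trans (sim_symm Λ hsim) (sim_cons x hV)⟩⟩
    · have hadj := adm_not_adj Λ x T hS.1 hT hxT
      have hfix : wSig Λ x d = d := by
        apply wSig_fix
        intro l hl
        apply nann_supp Λ hdT
        intro hlT
        rcases hl with rfl | hl
        · exact hxT hlT
        · exact hl (hadj l hlT)
      rcases hdS with h | ⟨h0, h1⟩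
      · have := nann_supp Λ hdT x hxT
        rw [h] at this
        simp at this
      have hTx : Admissible Λ (x :: T) := by
        have h3 : Sim (edges Λ) (x :: T) (T ++ [x]) := by
          simpa using sim_move x T [] hadj
        refine sim_adm Λ (sim_symm Λ h3) ((adm_append _ _ _).2 ⟨hT, ?_, trivial⟩)
        clear h3 hdT hfix ih
        have hs := hS.1
        clear hS
        induction T generalizing Λ with
        | nil => exact hs
        | cons y T ihT =>
          simp only [List.mem_cons, not_or] at hxT
          refine ihT (flipO y Λ) hT.2 hxT.2 ?_ ?_ ?_
          · intro t ht; rw [edges_flipO]; exact hadj t (by simp [ht])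
          · rw [wSig_flipO, nann_flipO]; exact h1
          · exact (sink_flipO Λ y x (Ne.symm hxT.1)
              (by rw [edges_symm]; exact hadj y (by simp))).2 hs
      obtain ⟨R, hR, ⟨U, hU⟩, ⟨V, hV⟩⟩ := ih (flipO x Λ) T (wSig Λ x d) hS.2 hTx.2
        ((nann_flipO _ _ _ _).2 h1) ((nann_flipO _ _ _ _).2 (by rw [hfix]; exact hdT))
      rw [nann_flipO, hfix] at hR
      rw [edges_flipO] at hU hV
      refine ⟨R, hR, ⟨x :: U, ?_⟩, ⟨V, hV⟩⟩
      refine sim_trans (sim_cons x hU) (sim_move x R U ?_)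
      intro r hr
      exact hadj r ((sim_perm hV).mem_iff.2 (by simp [hr]))

end Combin

section Reps

theorem castL_apply {k : Type} [Field k] {m m' : ℕ} (h : m = m') (v : Fin m → k) (i : Fin m') :
    castL k h v i = v (Fin.cast h.symm i) := rfl

theorem castL_castL {k : Type} [Field k] {m m' m'' : ℕ} (h : m = m') (h' : m' = m'')
    (v : Fin m → k) : castL k h' (castL k h v) = castL k (h.trans h') v := by
  subst h; subst h'; rfl

theorem castL_refl {k : Type} [Field k] {m : ℕ} (h : m = m) (v : Fin m → k) :
    castL k h v = v := rfl

theorem repIso_symm {k : Type} [Field k] {n : ℕ} {Λ : Fin n → Fin n → ℕ} {M N : Rep k n Λ}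
    (h : RepIso M N) : RepIso N M := by
  obtain ⟨g, hg⟩ := h
  refine ⟨fun x => (g x).symm, fun a b i v => ?_⟩
  apply (g b).injective
  rw [hg]; simp

theorem repIso_refl {k : Type} [Field k] {n : ℕ} {Λ : Fin n → Fin n → ℕ} (M : Rep k n Λ) :
    RepIso M M := ⟨fun _ => LinearEquiv.refl _ _, fun _ _ _ _ => rfl⟩

theorem repIso_dim {k : Type} [Field k] {n : ℕ} {Λ : Fin n → Fin n → ℕ} {M N : Rep k n Λ}
    (h : RepIso M N) : M.d = N.d := by
  obtain ⟨g, hg⟩ := h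
  funext x
  simpa using (g x).finrank_eq

theorem inMap_apply {k : Type} [Field k] {n : ℕ} (Λ : Fin n → Fin n → ℕ) (M : Rep k n Λ)
    (x : Fin n) (u : (p : Arin Λ x) → (Fin (M.d p.1) → k)) :
    inMap Λ M x u = ∑ p : Arin Λ x, M.f p.1 x p.2 (u p) := by
  simp [inMap]

theorem inMap_single {k : Type} [Field k] {n : ℕ} (Λ : Fin n → Fin n → ℕ) (M : Rep k n Λ)
    (x : Fin n) (p : Arin Λ x) (v : Fin (M.d p.1) → k) :
    inMap Λ M x (Pi.single p v) = M.f p.1 x p.2 v := by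
  rw [inMap_apply, Finset.sum_eq_single p]
  · simp
  · intro q _ hq; simp [hq]
  · simp

/-- The identification of the spaces of a direct sum. -/
def dsJoin {k : Type} [Field k] {n : ℕ} {Λ : Fin n → Fin n → ℕ} (A B : Rep k n Λ) (z : Fin n) :
    ((Fin (A.d z) → k) × (Fin (B.d z) → k)) ≃ₗ[k] (Fin ((dSum A B).d z) → k) :=
  (splitL k (A.d z) (B.d z)).symm

theorem dSum_f_join {k : Type} [Field k] {n : ℕ} {Λ : Fin n → Fin n → ℕ} (A B : Rep k n Λ)
    (a b : Fin n) (i : Fin (Λ a b)) (p : Fin (A.d a) → k) (q : Fin (B.d a) → k) :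
    (dSum A B).f a b i (dsJoin A B a (p, q)) = dsJoin A B b (A.f a b i p, B.f a b i q) := by
  show (splitL k (A.d b) (B.d b)).symm (LinearMap.prodMap (A.f a b i) (B.f a b i)
    (splitL k (A.d a) (B.d a) ((splitL k (A.d a) (B.d a)).symm (p, q)))) = _
  rw [LinearEquiv.apply_symm_apply]
  rfl

/-- Decomposition from complementary subrepresentations. -/
theorem decomp_of_compl {k : Type} [Field k] {n : ℕ} {Λ : Fin n → Fin n → ℕ} (M : Rep k n Λ)
    (P Q : ∀ z, Submodule k (Fin (M.d z) → k)) (hc : ∀ z, IsCompl (P z) (Q z))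
    (hP : ∀ a b i v, v ∈ P a → M.f a b i v ∈ P b)
    (hQ : ∀ a b i v, v ∈ Q a → M.f a b i v ∈ Q b) :
    ∃ A B : Rep k n Λ, RepIso M (dSum A B) ∧ (∀ z, A.d z = Module.finrank k (P z)) ∧
      ∀ z, B.d z = Module.finrank k (Q z) := by
  let eP : ∀ z, P z ≃ₗ[k] (Fin (Module.finrank k (P z)) → k) :=
    fun z => (Module.finBasis k (P z)).equivFun
  let eQ : ∀ z, Q z ≃ₗ[k] (Fin (Module.finrank k (Q z)) → k) :=
    fun z => (Module.finBasis k (Q z)).equivFun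
  let A : Rep k n Λ :=
    { d := fun z => Module.finrank k (P z)
      f := fun a b i => (eP b).toLinearMap ∘ₗ
        ((M.f a b i).restrict (hP a b i)) ∘ₗ (eP a).symm.toLinearMap }
  let B : Rep k n Λ :=
    { d := fun z => Module.finrank k (Q z)
      f := fun a b i => (eQ b).toLinearMap ∘ₗ
        ((M.f a b i).restrict (hQ a b i)) ∘ₗ (eQ a).symm.toLinearMap }
  refine ⟨A, B, repIso_symm ⟨fun z => (dsJoin A B z).symm.trans
    (((eP z).symm.prodCongr (eQ z).symm).trans (Submodule.prodEquivOfIsCompl _ _ (hc z))), ?_⟩,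
    fun _ => rfl, fun _ => rfl⟩
  intro a b i v
  obtain ⟨⟨p, q⟩, rfl⟩ := (dsJoin A B a).surjective v
  rw [dSum_f_join]
  simp only [LinearEquiv.trans_apply, LinearEquiv.symm_apply_apply]
  simp [A, B]

/-- The relation between a representation and its reflection. -/
def RefRel {k : Type} [Field k] {n : ℕ} (x : Fin n) (Λ : Fin n → Fin n → ℕ) (M : Rep k n Λ)
    (N : Rep k n (flipO x Λ)) : Prop :=
  ∃ e : ∀ z, (Fin (M.d z) → k) →ₗ[k] (Fin (N.d z) → k),
    (∀ z, z ≠ x → Function.Bijective (e z)) ∧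
    (∀ a b, a ≠ x → b ≠ x → ∀ (i : Fin (Λ a b)) (i' : Fin (flipO x Λ a b)),
      (i : ℕ) = i' → ∀ v, e b (M.f a b i v) = N.f a b i' (e a v)) ∧
    (∀ u, inMap Λ M x u = 0 ↔ ∃ v, ∀ (p : Arin Λ x) (i' : Fin (flipO x Λ x p.1)),
      (p.2 : ℕ) = i' → e p.1 (u p) = N.f x p.1 i' v)

theorem flipO_left {n : ℕ} (x : Fin n) (Λ : Fin n → Fin n → ℕ) (b : Fin n) :
    flipO x Λ x b = Λ b x := by simp [flipO]

theorem flipO_right {n : ℕ} (x : Fin n) (Λ : Fin n → Fin n → ℕ) (b : Fin n) :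
    flipO x Λ b x = Λ x b := by simp [flipO]

theorem flipO_ne {n : ℕ} (x : Fin n) (Λ : Fin n → Fin n → ℕ) (a b : Fin n) (ha : a ≠ x)
    (hb : b ≠ x) : flipO x Λ a b = Λ a b := by simp [flipO, ha, hb]

/-- A representation over `(Γ, Λ)` with surjective `inMap` is determined by its reflection. -/
theorem refRel_unique {k : Type} [Field k] {n : ℕ} (x : Fin n) (Λ : Fin n → Fin n → ℕ)
    (hx : IsSink Λ x) (M₁ M₂ : Rep k n Λ) (N₁ N₂ : Rep k n (flipO x Λ))
    (h₁ : RefRel x Λ M₁ N₁) (h₂ : RefRel x Λ M₂ N₂)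
    (s₁ : Function.Surjective (inMap Λ M₁ x)) (s₂ : Function.Surjective (inMap Λ M₂ x))
    (hN : RepIso N₁ N₂) : RepIso M₁ M₂ := by
  obtain ⟨e₁, b₁, c₁, x₁⟩ := h₁
  obtain ⟨e₂, b₂, c₂, x₂⟩ := h₂
  obtain ⟨g, hg⟩ := hN
  have hne : ∀ p : Arin Λ x, p.1 ≠ x := by
    rintro ⟨y, i⟩ hy
    change y = x at hy
    rw [hy, hx x] at i; exact i.elim0
  -- equivalences away from x
  have hH : ∀ z, z ≠ x → ∃ h : (Fin (M₁.d z) → k) ≃ₗ[k] (Fin (M₂.d z) → k),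
      ∀ v, e₂ z (h v) = g z (e₁ z v) := by
    intro z hz
    refine ⟨(LinearEquiv.ofBijective (e₁ z) (b₁ z hz)).trans ((g z).trans
      (LinearEquiv.ofBijective (e₂ z) (b₂ z hz)).symm), fun v => ?_⟩
    exact (LinearEquiv.ofBijective (e₂ z) (b₂ z hz)).apply_symm_apply _
  choose h hh using hH
  let H : ((p : Arin Λ x) → (Fin (M₁.d p.1) → k)) ≃ₗ[k]
      ((p : Arin Λ x) → (Fin (M₂.d p.1) → k)) := LinearEquiv.piCongrRight fun p => h p.1 (hne p)
  have hker : (LinearMap.ker (inMap Λ M₁ x)).map H.toLinearMap = LinearMap.ker (inMap Λ M₂ x) := by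
    ext u
    obtain ⟨u, rfl⟩ := H.surjective u
    have : H u ∈ (LinearMap.ker (inMap Λ M₁ x)).map H.toLinearMap ↔
        u ∈ LinearMap.ker (inMap Λ M₁ x) := by
      constructor
      · rintro ⟨u', hu', h'⟩
        rwa [← H.injective h']
      · intro hu; exact ⟨u, hu, rfl⟩
    rw [this, LinearMap.mem_ker, LinearMap.mem_ker, x₁, x₂]
    have key : ∀ p, e₂ p.1 (H u p) = g p.1 (e₁ p.1 (u p)) := fun p => hh p.1 (hne p) (u p)
    constructor
    · rintro ⟨v, hv⟩
      refine ⟨g x v, fun p i' hi => ?_⟩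
      rw [key, hv p i' hi, hg]
    · rintro ⟨v, hv⟩
      refine ⟨(g x).symm v, fun p i' hi => ?_⟩
      apply (g p.1).injective
      rw [← key, hv p i' hi, hg]; simp
  let hx' : (Fin (M₁.d x) → k) ≃ₗ[k] (Fin (M₂.d x) → k) :=
    ((inMap Λ M₁ x).quotKerEquivOfSurjective s₁).symm.trans
      ((Submodule.Quotient.equiv _ _ H hker).trans
        ((inMap Λ M₂ x).quotKerEquivOfSurjective s₂))
  have hx'_in : ∀ u, hx' (inMap Λ M₁ x u) = inMap Λ M₂ x (H u) := by
    intro u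
    have : ((inMap Λ M₁ x).quotKerEquivOfSurjective s₁).symm (inMap Λ M₁ x u) =
        Submodule.Quotient.mk u := by
      rw [LinearEquiv.symm_apply_eq]; rfl
    simp only [hx', LinearEquiv.trans_apply, this]
    rfl
  have hall : ∀ z, ∃ G : (Fin (M₁.d z) → k) ≃ₗ[k] (Fin (M₂.d z) → k),
      (∀ hz : z ≠ x, G = h z hz) ∧ (z = x → ∀ y (hy : y ≠ x) (i : Fin (Λ y z)) v,
        G (M₁.f y z i v) = M₂.f y z i (h y hy v)) := by
    intro z
    by_cases hz : z = x
    · subst hz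
      refine ⟨hx', fun h => (h rfl).elim, fun _ y hy i v => ?_⟩
      have h1 := inMap_single Λ M₁ z ⟨y, i⟩ v
      rw [← h1, hx'_in]
      have h2 : H (Pi.single ⟨y, i⟩ v) = Pi.single (⟨y, i⟩ : Arin Λ z) (h y hy v) := by
        funext p
        show h p.1 (hne p) (Pi.single (M := fun p : Arin Λ z => Fin (M₁.d p.1) → k) ⟨y, i⟩ v p) = _
        by_cases hp : p = ⟨y, i⟩
        · subst hp; simp
        · simp [hp]
      rw [h2, inMap_single]
    · exact ⟨h z hz, fun _ => rfl, fun h => (hz h).elim⟩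
  choose G hG1 hG2 using hall
  refine ⟨G, fun a b i v => ?_⟩
  have ha : a ≠ x := by
    rintro rfl
    rw [hx b] at i; exact i.elim0
  by_cases hb : b = x
  · rw [hG2 b hb a ha, hG1 a ha]
  · rw [hG1 a ha, hG1 b hb]
    apply (b₂ b hb).injective
    have hi : (i : ℕ) = Fin.cast (flipO_ne x Λ a b ha hb).symm i := rfl
    rw [hh b hb, c₁ a b ha hb i _ hi, c₂ a b ha hb i _ hi, hg, hh a ha]

end Reps

section Refl

theorem reflPlus_d_self {k : Type} [Field k] {n : ℕ} (x : Fin n) (Λ : Fin n → Fin n → ℕ)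
    (M : Rep k n Λ) : (reflPlus x Λ M).d x = Module.finrank k (LinearMap.ker (inMap Λ M x)) :=
  if_pos rfl

theorem reflPlus_d_ne {k : Type} [Field k] {n : ℕ} (x : Fin n) (Λ : Fin n → Fin n → ℕ)
    (M : Rep k n Λ) {z : Fin n} (hz : z ≠ x) : (reflPlus x Λ M).d z = M.d z :=
  if_neg hz

theorem reflPlus_f_out {k : Type} [Field k] {n : ℕ} (x : Fin n) (Λ : Fin n → Fin n → ℕ)
    (M : Rep k n Λ) {b : Fin n} (hb : b ≠ x) (i : Fin (flipO x Λ x b))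
    (v : Fin ((reflPlus x Λ M).d x) → k) :
    (reflPlus x Λ M).f x b i v = castL k (reflPlus_d_ne x Λ M hb).symm
      (((kerEquiv Λ M x).symm (castL k (reflPlus_d_self x Λ M) v)).1
        ⟨b, Fin.cast (flipO_left x Λ b) i⟩) := by
  unfold reflPlus
  simp only [dif_neg hb]
  rfl

theorem reflPlus_f_ne {k : Type} [Field k] {n : ℕ} (x : Fin n) (Λ : Fin n → Fin n → ℕ)
    (M : Rep k n Λ) {a b : Fin n} (ha : a ≠ x) (hb : b ≠ x) (i : Fin (flipO x Λ a b))
    (v : Fin ((reflPlus x Λ M).d a) → k) :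
    (reflPlus x Λ M).f a b i v = castL k (reflPlus_d_ne x Λ M hb).symm
      (M.f a b (Fin.cast (flipO_ne x Λ a b ha hb) i)
        (castL k (reflPlus_d_ne x Λ M ha) v)) := by
  unfold reflPlus
  simp only [dif_neg ha, dif_neg hb]
  rfl

theorem arin_ne {n : ℕ} {x : Fin n} {Λ : Fin n → Fin n → ℕ} (hx : Λ x x = 0)
    (p : Arin Λ x) : p.1 ≠ x := by
  obtain ⟨y, i⟩ := p
  intro hy
  change y = x at hy
  rw [hy, hx] at i; exact i.elim0

theorem refRel_reflPlus {k : Type} [Field k] {n : ℕ} (x : Fin n) (Λ : Fin n → Fin n → ℕ)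
    (hx : Λ x x = 0) (M : Rep k n Λ) : RefRel x Λ M (reflPlus x Λ M) := by
  have he : ∀ z, ∃ e : (Fin (M.d z) → k) →ₗ[k] (Fin ((reflPlus x Λ M).d z) → k),
      ∀ hz : z ≠ x, e = (castL k (reflPlus_d_ne x Λ M hz).symm).toLinearMap := by
    intro z
    by_cases hz : z = x
    · exact ⟨0, fun h => (h hz).elim⟩
    · exact ⟨(castL k (reflPlus_d_ne x Λ M hz).symm).toLinearMap, fun _ => rfl⟩
  choose e he using he
  refine ⟨e, ?_, ?_, ?_⟩
  · intro z hz
    rw [he z hz]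
    exact (castL k (reflPlus_d_ne x Λ M hz).symm).bijective
  · intro a b ha hb i i' hi v
    rw [he a ha, he b hb, reflPlus_f_ne x Λ M ha hb]
    have : Fin.cast (flipO_ne x Λ a b ha hb) i' = i := Fin.ext hi.symm
    rw [this]
    simp [castL_castL, castL_refl]
  · intro u
    constructor
    · intro hu
      refine ⟨castL k (reflPlus_d_self x Λ M).symm (kerEquiv Λ M x ⟨u, hu⟩), ?_⟩
      rintro ⟨y, i⟩ i' hi
      have hp : y ≠ x := arin_ne hx ⟨y, i⟩
      have hi2 : i = Fin.cast (flipO_left x Λ y) i' := Fin.ext hi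
      show e y (u ⟨y, i⟩) = (reflPlus x Λ M).f x y i' _
      rw [hi2, he y hp, reflPlus_f_out x Λ M hp, castL_castL, castL_refl,
        LinearEquiv.symm_apply_apply]
      rfl
    · rintro ⟨v, hv⟩
      set w := (kerEquiv Λ M x).symm (castL k (reflPlus_d_self x Λ M) v) with hw
      have : u = w.1 := by
        funext p
        have hp := arin_ne hx p
        have h1 := hv p (Fin.cast (flipO_left x Λ p.1).symm p.2) rfl
        rw [he _ hp, reflPlus_f_out x Λ M hp] at h1
        exact (castL k (reflPlus_d_ne x Λ M hp).symm).injective h1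
      rw [this]
      exact w.2

theorem reflPlus_out_inj {k : Type} [Field k] {n : ℕ} (x : Fin n) (Λ : Fin n → Fin n → ℕ)
    (hx : Λ x x = 0) (M : Rep k n Λ) (v : Fin ((reflPlus x Λ M).d x) → k)
    (hv : ∀ b i, (reflPlus x Λ M).f x b i v = 0) : v = 0 := by
  have : (kerEquiv Λ M x).symm (castL k (reflPlus_d_self x Λ M) v) = 0 := by
    apply Subtype.ext
    funext p
    have hp := arin_ne hx p
    have h1 := hv p.1 (Fin.cast (flipO_left x Λ p.1).symm p.2)
    rw [reflPlus_f_out x Λ M hp] at h1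
    exact (LinearEquiv.map_eq_zero_iff _).1 h1
  simpa using this

/-! negative reflection -/

theorem reflMinus_d_self {k : Type} [Field k] {n : ℕ} (x : Fin n) (Λ : Fin n → Fin n → ℕ)
    (N : Rep k n (flipO x Λ)) : (reflMinus x Λ N).d x =
      Module.finrank k (((p : Aout (flipO x Λ) x) → (Fin (N.d p.1) → k)) ⧸
        LinearMap.range (outMap (flipO x Λ) N x)) :=
  if_pos rfl

theorem reflMinus_d_ne {k : Type} [Field k] {n : ℕ} (x : Fin n) (Λ : Fin n → Fin n → ℕ)
    (N : Rep k n (flipO x Λ)) {z : Fin n} (hz : z ≠ x) : (reflMinus x Λ N).d z = N.d z :=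
  if_neg hz

theorem reflMinus_f_in {k : Type} [Field k] {n : ℕ} (x : Fin n) (Λ : Fin n → Fin n → ℕ)
    (N : Rep k n (flipO x Λ)) {a : Fin n} (ha : a ≠ x) (i : Fin (Λ a x))
    (v : Fin ((reflMinus x Λ N).d a) → k) :
    (reflMinus x Λ N).f a x i v = castL k (reflMinus_d_self x Λ N).symm
      (cokerEquiv (flipO x Λ) N x ((LinearMap.range (outMap (flipO x Λ) N x)).mkQ
        (Pi.single (⟨a, Fin.cast (flipO_left x Λ a).symm i⟩ : Aout (flipO x Λ) x)
          (castL k (reflMinus_d_ne x Λ N ha) v)))) := by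
  unfold reflMinus
  simp only [dif_neg ha]
  rfl

theorem reflMinus_f_ne {k : Type} [Field k] {n : ℕ} (x : Fin n) (Λ : Fin n → Fin n → ℕ)
    (N : Rep k n (flipO x Λ)) {a b : Fin n} (ha : a ≠ x) (hb : b ≠ x) (i : Fin (Λ a b))
    (v : Fin ((reflMinus x Λ N).d a) → k) :
    (reflMinus x Λ N).f a b i v = castL k (reflMinus_d_ne x Λ N hb).symm
      (N.f a b (Fin.cast (flipO_ne x Λ a b ha hb).symm i)
        (castL k (reflMinus_d_ne x Λ N ha) v)) := by
  unfold reflMinus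
  simp only [dif_neg ha, dif_neg hb]
  rfl

/-- Arrows into `x` correspond to arrows out of `x` after reversal. -/
def arEquiv {n : ℕ} (x : Fin n) (Λ : Fin n → Fin n → ℕ) : Arin Λ x ≃ Aout (flipO x Λ) x :=
  Equiv.sigmaCongrRight fun y => finCongr (flipO_left x Λ y).symm

theorem reflMinus_inMap {k : Type} [Field k] {n : ℕ} (x : Fin n) (Λ : Fin n → Fin n → ℕ)
    (hx : Λ x x = 0) (N : Rep k n (flipO x Λ))
    (u : (p : Arin Λ x) → (Fin ((reflMinus x Λ N).d p.1) → k))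
    (w : (p : Aout (flipO x Λ) x) → (Fin (N.d p.1) → k))
    (huw : ∀ p, w (arEquiv x Λ p) = castL k (reflMinus_d_ne x Λ N (arin_ne hx p)) (u p)) :
    inMap Λ (reflMinus x Λ N) x u = castL k (reflMinus_d_self x Λ N).symm
      (cokerEquiv (flipO x Λ) N x ((LinearMap.range (outMap (flipO x Λ) N x)).mkQ w)) := by
  rw [inMap_apply]
  have h1 : ∀ p : Arin Λ x, (reflMinus x Λ N).f p.1 x p.2 (u p) =
      castL k (reflMinus_d_self x Λ N).symm
      (cokerEquiv (flipO x Λ) N x ((LinearMap.range (outMap (flipO x Λ) N x)).mkQ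
        (Pi.single (arEquiv x Λ p) (w (arEquiv x Λ p))))) := by
    intro p
    rw [reflMinus_f_in x Λ N (arin_ne hx p), huw]
    rfl
  rw [Finset.sum_congr rfl fun p _ => h1 p, ← map_sum, ← map_sum, ← map_sum]
  congr 3
  rw [Equiv.sum_comp (arEquiv x Λ) (fun q => Pi.single q (w q)), Finset.univ_sum_single]

theorem refRel_reflMinus {k : Type} [Field k] {n : ℕ} (x : Fin n) (Λ : Fin n → Fin n → ℕ)
    (hx : Λ x x = 0) (N : Rep k n (flipO x Λ)) :
    RefRel x Λ (reflMinus x Λ N) N ∧ Function.Surjective (inMap Λ (reflMinus x Λ N) x) := by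
  constructor
  · have he : ∀ z, ∃ e : (Fin ((reflMinus x Λ N).d z) → k) →ₗ[k] (Fin (N.d z) → k),
        ∀ hz : z ≠ x, e = (castL k (reflMinus_d_ne x Λ N hz)).toLinearMap := by
      intro z
      by_cases hz : z = x
      · exact ⟨0, fun h => (h hz).elim⟩
      · exact ⟨(castL k (reflMinus_d_ne x Λ N hz)).toLinearMap, fun _ => rfl⟩
    choose e he using he
    refine ⟨e, ?_, ?_, ?_⟩
    · intro z hz
      rw [he z hz]
      exact (castL k (reflMinus_d_ne x Λ N hz)).bijective
    · intro a b ha hb i i' hi v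
      rw [he a ha, he b hb, reflMinus_f_ne x Λ N ha hb]
      have : Fin.cast (flipO_ne x Λ a b ha hb).symm i = i' := Fin.ext hi
      rw [this]
      simp [castL_castL, castL_refl]
    · intro u
      let w : (p : Aout (flipO x Λ) x) → (Fin (N.d p.1) → k) :=
        fun p => e p.1 (u ((arEquiv x Λ).symm p))
      have hw : ∀ p, w (arEquiv x Λ p) = e p.1 (u p) := by
        rintro ⟨y, i⟩; rfl
      rw [reflMinus_inMap x Λ hx N u w (fun p => by rw [hw, he _ (arin_ne hx p)]; rfl),
        LinearEquiv.map_eq_zero_iff, LinearEquiv.map_eq_zero_iff, Submodule.mkQ_apply,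
        Submodule.Quotient.mk_eq_zero]
      constructor
      · rintro ⟨v, hv⟩
        refine ⟨v, fun p i' hi => ?_⟩
        rw [← hw, ← hv]
        have : i' = Fin.cast (flipO_left x Λ p.1).symm p.2 := Fin.ext hi.symm
        rw [this]
        rfl
      · rintro ⟨v, hv⟩
        refine ⟨v, ?_⟩
        funext q
        obtain ⟨p, rfl⟩ := (arEquiv x Λ).surjective q
        rw [hw]
        exact (hv p _ rfl).symm
  · intro y
    obtain ⟨y, rfl⟩ := (castL k (reflMinus_d_self x Λ N).symm).surjective y
    obtain ⟨y, rfl⟩ := (cokerEquiv (flipO x Λ) N x).surjective y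
    obtain ⟨w, rfl⟩ := Submodule.mkQ_surjective _ y
    refine ⟨fun p => castL k (reflMinus_d_ne x Λ N (arin_ne hx p)).symm (w (arEquiv x Λ p)), ?_⟩
    apply reflMinus_inMap x Λ hx N
    intro p
    exact (castL_castL _ _ _).symm

/-! direct sums -/

theorem inMap_dSum {k : Type} [Field k] {n : ℕ} (Λ : Fin n → Fin n → ℕ) (A B : Rep k n Λ)
    (x : Fin n) (u : (p : Arin Λ x) → (Fin (A.d p.1) → k))
    (w : (p : Arin Λ x) → (Fin (B.d p.1) → k)) :
    inMap Λ (dSum A B) x (fun p => dsJoin A B p.1 (u p, w p)) =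
      dsJoin A B x (inMap Λ A x u, inMap Λ B x w) := by
  simp only [inMap_apply, dSum_f_join, ← map_sum]
  congr 1
  rw [Prod.ext_iff]
  simp [Prod.fst_sum, Prod.snd_sum]

theorem dSum_family {k : Type} [Field k] {n : ℕ} (Λ : Fin n → Fin n → ℕ) (A B : Rep k n Λ)
    (x : Fin n) (t : (p : Arin Λ x) → (Fin ((dSum A B).d p.1) → k)) :
    ∃ (u : (p : Arin Λ x) → (Fin (A.d p.1) → k)) (w : (p : Arin Λ x) → (Fin (B.d p.1) → k)), t = fun p => dsJoin A B p.1 (u p, w p) :=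
  ⟨fun p => ((dsJoin A B p.1).symm (t p)).1, fun p => ((dsJoin A B p.1).symm (t p)).2, by
    funext p; simp⟩

theorem surj_dSum {k : Type} [Field k] {n : ℕ} (Λ : Fin n → Fin n → ℕ) (A B : Rep k n Λ)
    (x : Fin n) (hA : Function.Surjective (inMap Λ A x))
    (hB : Function.Surjective (inMap Λ B x)) : Function.Surjective (inMap Λ (dSum A B) x) := by
  intro y
  obtain ⟨⟨p, q⟩, rfl⟩ := (dsJoin A B x).surjective y
  obtain ⟨u, rfl⟩ := hA p
  obtain ⟨w, rfl⟩ := hB q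
  exact ⟨_, inMap_dSum Λ A B x u w⟩

theorem refRel_dSum {k : Type} [Field k] {n : ℕ} (x : Fin n) (Λ : Fin n → Fin n → ℕ)
    (A B : Rep k n Λ) (A' B' : Rep k n (flipO x Λ)) (hA : RefRel x Λ A A')
    (hB : RefRel x Λ B B') : RefRel x Λ (dSum A B) (dSum A' B') := by
  obtain ⟨e₁, b₁, c₁, x₁⟩ := hA
  obtain ⟨e₂, b₂, c₂, x₂⟩ := hB
  let e : ∀ z, (Fin ((dSum A B).d z) → k) →ₗ[k] (Fin ((dSum A' B').d z) → k) := fun z =>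
    (dsJoin A' B' z).toLinearMap ∘ₗ (LinearMap.prodMap (e₁ z) (e₂ z)) ∘ₗ
      (dsJoin A B z).symm.toLinearMap
  have he : ∀ z p q, e z (dsJoin A B z (p, q)) = dsJoin A' B' z (e₁ z p, e₂ z q) := by
    intro z p q; simp [e]
  refine ⟨e, ?_, ?_, ?_⟩
  · intro z hz
    exact (dsJoin A' B' z).bijective.comp
      (((b₁ z hz).prodMap (b₂ z hz)).comp (dsJoin A B z).symm.bijective)
  · intro a b ha hb i i' hi v
    obtain ⟨⟨p, q⟩, rfl⟩ := (dsJoin A B a).surjective v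
    rw [dSum_f_join, he, he, dSum_f_join, c₁ a b ha hb i i' hi, c₂ a b ha hb i i' hi]
  · intro t
    obtain ⟨u, w, rfl⟩ := dSum_family Λ A B x t
    rw [inMap_dSum, LinearEquiv.map_eq_zero_iff, Prod.mk_eq_zero, x₁, x₂]
    constructor
    · rintro ⟨⟨p, hp⟩, ⟨q, hq⟩⟩
      refine ⟨dsJoin A' B' x (p, q), fun r i' hi => ?_⟩
      rw [he, dSum_f_join, hp r i' hi, hq r i' hi]
    · rintro ⟨v, hv⟩
      obtain ⟨⟨p, q⟩, rfl⟩ := (dsJoin A' B' x).surjective v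
      have hh : ∀ (r : Arin Λ x) (i' : Fin (flipO x Λ x r.1)), (r.2 : ℕ) = i' →
          e₁ r.1 (u r) = A'.f x r.1 i' p ∧ e₂ r.1 (w r) = B'.f x r.1 i' q := by
        intro r i' hi
        have := hv r i' hi
        rw [he, dSum_f_join] at this
        exact Prod.mk.inj ((dsJoin A' B' r.1).injective this)
      exact ⟨⟨p, fun r i' hi => (hh r i' hi).1⟩, ⟨q, fun r i' hi => (hh r i' hi).2⟩⟩

/-! indecomposables -/

theorem indec_surj {k : Type} [Field k] {n : ℕ} (x : Fin n) (Λ : Fin n → Fin n → ℕ)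
    (hx : IsSink Λ x) (M : Rep k n Λ) (hM : Indecomp M) (h : ∃ z, z ≠ x ∧ M.d z ≠ 0) :
    Function.Surjective (inMap Λ M x) := by
  let P : ∀ z, Submodule k (Fin (M.d z) → k) := fun z =>
    if z = x then LinearMap.range (inMap Λ M z) else ⊤
  have hPx : P x = LinearMap.range (inMap Λ M x) := if_pos rfl
  have hPn : ∀ z, z ≠ x → P z = ⊤ := fun z hz => if_neg hz
  choose Q hQ using fun z => Submodule.exists_isCompl (P z)
  have hQn : ∀ z, z ≠ x → Q z = ⊥ := by
    intro z hz
    have := hQ z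
    rw [hPn z hz] at this
    exact top_disjoint.1 this.disjoint
  have hP' : ∀ a b i v, v ∈ P a → M.f a b i v ∈ P b := by
    intro a b i v _
    by_cases hb : b = x
    · subst hb
      rw [hPx]
      exact ⟨Pi.single ⟨a, i⟩ v, inMap_single Λ M b ⟨a, i⟩ v⟩
    · rw [hPn b hb]; trivial
  have hQ' : ∀ a b i v, v ∈ Q a → M.f a b i v ∈ Q b := by
    intro a b i v hv
    by_cases ha : a = x
    · subst ha
      rw [hx b] at i; exact i.elim0
    · rw [hQn a ha, Submodule.mem_bot] at hv
      rw [hv, map_zero]; exact Submodule.zero_mem _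
  obtain ⟨A, B, hAB, hA, hB⟩ := decomp_of_compl M P Q hQ hP' hQ'
  · obtain ⟨z, hz, hMz⟩ := h
    rcases hM.2 A B hAB with h0 | h0
    · have := hA z
      rw [h0 z, hPn z hz] at this
      simp at this
      exact (hMz this.symm).elim
    · have h1 : Q x = ⊥ := by
        have := hB x
        rw [h0 x] at this
        exact Submodule.finrank_eq_zero.1 this.symm
      have h2 := hQ x
      rw [h1, hPx] at h2
      exact LinearMap.range_eq_top.1 (codisjoint_bot.1 h2.codisjoint)

theorem indec_simple {k : Type} [Field k] {n : ℕ} (x : Fin n) (Λ : Fin n → Fin n → ℕ)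
    (hx : IsSink Λ x) (M : Rep k n Λ) (hM : Indecomp M) (h : ∀ z, z ≠ x → M.d z = 0) :
    M.d x = 1 := by
  let P : ∀ z, Submodule k (Fin (M.d z) → k) := fun z => Submodule.span k {fun _ => 1}
  choose Q hQ using fun z => Submodule.exists_isCompl (P z)
  have hx0 : M.d x ≠ 0 := by
    intro h0
    apply hM.1
    intro z
    by_cases hz : z = x
    · rw [hz]; exact h0
    · exact h z hz
  have hf : ∀ a b i v, M.f a b i v = 0 := by
    intro a b i v
    by_cases ha : a = x
    · subst ha
      rw [hx b] at i; exact i.elim0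
    · have : v = 0 := by
        funext j
        rw [h a ha] at j
        exact j.elim0
      rw [this, map_zero]
  have hP1 : Module.finrank k (P x) = 1 := by
    apply finrank_span_singleton
    intro h0
    have := congrFun h0 ⟨0, Nat.pos_of_ne_zero hx0⟩
    simp at this
  obtain ⟨A, B, hAB, hA, hB⟩ := decomp_of_compl M P Q hQ
    (fun a b i v _ => by rw [hf]; exact Submodule.zero_mem _)
    (fun a b i v _ => by rw [hf]; exact Submodule.zero_mem _)
  rcases hM.2 A B hAB with h0 | h0
  · have := hA x
    rw [h0 x, hP1] at this
    omega
  · have := congrFun (repIso_dim hAB) x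
    change M.d x = A.d x + B.d x at this
    rw [this, hA x, hP1, h0 x]

theorem reflPlus_zero_iff {k : Type} [Field k] {n : ℕ} (x : Fin n) (Λ : Fin n → Fin n → ℕ)
    (hx : Λ x x = 0) (M : Rep k n Λ) :
    IsZeroRep (reflPlus x Λ M) ↔ ∀ z, z ≠ x → M.d z = 0 := by
  constructor
  · intro h z hz
    rw [← reflPlus_d_ne x Λ M hz]; exact h z
  · intro h z
    by_cases hz : z = x
    · subst hz
      rw [reflPlus_d_self]
      apply Submodule.finrank_eq_zero.2
      rw [eq_bot_iff]
      intro u _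
      rw [Submodule.mem_bot]
      funext p j
      rw [h p.1 (arin_ne hx p)] at j
      exact j.elim0
    · rw [reflPlus_d_ne x Λ M hz]; exact h z hz

theorem reflPlus_indec {k : Type} [Field k] {n : ℕ} (x : Fin n) (Λ : Fin n → Fin n → ℕ)
    (hx : IsSink Λ x) (M : Rep k n Λ) (hM : Indecomp M) (h : ¬ IsZeroRep (reflPlus x Λ M)) :
    Indecomp (reflPlus x Λ M) := by
  have hs : Function.Surjective (inMap Λ M x) := by
    apply indec_surj x Λ hx M hM
    rw [reflPlus_zero_iff x Λ (hx x)] at h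
    push Not at h
    exact h
  refine ⟨h, fun A' B' hAB => ?_⟩
  obtain ⟨rA, sA⟩ := refRel_reflMinus x Λ (hx x) A'
  obtain ⟨rB, sB⟩ := refRel_reflMinus x Λ (hx x) B'
  have hiso := refRel_unique x Λ hx M _ _ _ (refRel_reflPlus x Λ (hx x) M)
    (refRel_dSum x Λ _ _ _ _ rA rB) hs (surj_dSum Λ _ _ x sA sB) hAB
  obtain ⟨g, hg⟩ := repIso_symm hAB
  have zero_of : ∀ C : Rep k n (flipO x Λ), (∀ z, z ≠ x → C.d z = 0) →
      (∀ v : Fin (C.d x) → k, v = 0) → IsZeroRep C := by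
    intro C h1 h2 z
    by_cases hz : z = x
    · subst hz
      by_contra h0
      have := congrFun (h2 fun _ => 1) ⟨0, Nat.pos_of_ne_zero h0⟩
      simp at this
    · exact h1 z hz
  have fzero : ∀ C : Rep k n (flipO x Λ), (∀ z, z ≠ x → C.d z = 0) →
      ∀ b i v, C.f x b i v = 0 := by
    intro C h1 b i v
    by_cases hb : b = x
    · subst hb
      rw [flipO_left, hx b] at i; exact i.elim0
    · funext j
      rw [h1 b hb] at j
      exact j.elim0
  rcases hM.2 _ _ hiso with h0 | h0
  · left
    have h1 : ∀ z, z ≠ x → A'.d z = 0 := fun z hz => by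
      rw [← reflMinus_d_ne x Λ A' hz]; exact h0 z
    refine zero_of A' h1 fun v => ?_
    have := reflPlus_out_inj x Λ (hx x) M (g x (dsJoin A' B' x (v, 0))) (fun b i => by
      rw [← hg, dSum_f_join, fzero A' h1, map_zero]
      exact (congrArg (g b) (map_zero (dsJoin A' B' b))).trans (map_zero (g b)))
    rw [LinearEquiv.map_eq_zero_iff, LinearEquiv.map_eq_zero_iff] at this
    exact congrArg Prod.fst this
  · right
    have h1 : ∀ z, z ≠ x → B'.d z = 0 := fun z hz => by
      rw [← reflMinus_d_ne x Λ B' hz]; exact h0 z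
    refine zero_of B' h1 fun v => ?_
    have := reflPlus_out_inj x Λ (hx x) M (g x (dsJoin A' B' x (0, v))) (fun b i => by
      rw [← hg, dSum_f_join, fzero B' h1, map_zero]
      exact (congrArg (g b) (map_zero (dsJoin A' B' b))).trans (map_zero (g b)))
    rw [LinearEquiv.map_eq_zero_iff, LinearEquiv.map_eq_zero_iff] at this
    exact congrArg Prod.snd this

/-- Dimension vector. -/
def dimV {k : Type} [Field k] {n : ℕ} {Λ : Fin n → Fin n → ℕ} (M : Rep k n Λ) : Fin n → ℤ :=
  fun z => (M.d z : ℤ)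

theorem reflPlus_dim {k : Type} [Field k] {n : ℕ} (x : Fin n) (Λ : Fin n → Fin n → ℕ)
    (hx : IsSink Λ x) (M : Rep k n Λ) (hs : Function.Surjective (inMap Λ M x)) :
    dimV (reflPlus x Λ M) = wSig Λ x (dimV M) := by
  funext z
  by_cases hz : z = x
  · subst hz
    have h1 := LinearMap.finrank_range_add_finrank_ker (inMap Λ M z)
    rw [LinearMap.range_eq_top.2 hs, finrank_top, Module.finrank_fin_fun, ← reflPlus_d_self,
      Module.finrank_pi_fintype] at h1
    simp only [Module.finrank_fin_fun] at h1
    rw [Fintype.sum_sigma] at h1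
    simp only [Finset.sum_const, Finset.card_univ, Fintype.card_fin, smul_eq_mul] at h1
    rw [wSig_apply]
    simp only [Pi.sub_apply, Pi.smul_apply, Pi.single_eq_same, smul_eq_mul, mul_one, dimV]
    have h2 : ∑ l, cartanOf Λ z l * (M.d l : ℤ) =
        2 * M.d z - ∑ l, (Λ l z : ℤ) * (M.d l : ℤ) := by
      have h3 : ∀ l, cartanOf Λ z l * (M.d l : ℤ) =
          (if l = z then 2 * (M.d z : ℤ) else 0) - (Λ l z : ℤ) * (M.d l : ℤ) := by
        intro l
        by_cases hl : l = z
        · subst hl; simp [cartan_diag, hx l]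
        · simp [cartanOf, hl, Ne.symm hl, edges, hx l]
      rw [Finset.sum_congr rfl fun l _ => h3 l, Finset.sum_sub_distrib]
      simp
    rw [h2]
    have h4 : (M.d z : ℤ) + (reflPlus z Λ M).d z = ∑ l, (Λ l z : ℤ) * (M.d l : ℤ) := by
      exact_mod_cast h1
    linarith
  · rw [wSig_apply_ne Λ x _ hz]
    simp [dimV, reflPlus_d_ne x Λ M hz]

end Refl

section Final

theorem refl_cases {k : Type} [Field k] {n : ℕ} (x : Fin n) (Λ : Fin n → Fin n → ℕ)
    (hx : IsSink Λ x) (M : Rep k n Λ) (hM : Indecomp M) :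
    (IsZeroRep (reflPlus x Λ M) ∧ dimV M = Pi.single x 1) ∨
    (Indecomp (reflPlus x Λ M) ∧ Function.Surjective (inMap Λ M x) ∧
      dimV (reflPlus x Λ M) = wSig Λ x (dimV M) ∧ dimV M ≠ Pi.single x 1) := by
  by_cases h : IsZeroRep (reflPlus x Λ M)
  · left
    refine ⟨h, ?_⟩
    rw [reflPlus_zero_iff x Λ (hx x)] at h
    funext z
    by_cases hz : z = x
    · subst hz
      simp [dimV, indec_simple z Λ hx M hM h]
    · simp [dimV, hz, h z hz]
  · right
    have hI := reflPlus_indec x Λ hx M hM h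
    rw [reflPlus_zero_iff x Λ (hx x)] at h
    push Not at h
    have hs := indec_surj x Λ hx M hM h
    refine ⟨hI, hs, reflPlus_dim x Λ hx M hs, fun h0 => ?_⟩
    obtain ⟨z, hz, hd⟩ := h
    have := congrFun h0 z
    simp [dimV, hz] at this
    exact hd this

theorem FList_zero {k : Type} [Field k] {n : ℕ} (Λ : Fin n → Fin n → ℕ) (S : List (Fin n))
    (hS : Admissible Λ S) (M : Rep k n Λ) (hM : IsZeroRep M) : IsZeroRep (FList S Λ M) := by
  induction S generalizing Λ with
  | nil => exact hM
  | cons x S ih =>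
    exact ih _ hS.2 _ ((reflPlus_zero_iff x Λ (hS.1 x) M).2 fun z _ => hM z)

theorem dimV_nonneg {k : Type} [Field k] {n : ℕ} {Λ : Fin n → Fin n → ℕ} (M : Rep k n Λ) :
    0 ≤ dimV M := fun z => Int.natCast_nonneg _

theorem ann_iff {k : Type} [Field k] {n : ℕ} (Λ : Fin n → Fin n → ℕ) (S : List (Fin n))
    (hS : Admissible Λ S) (M : Rep k n Λ) (hM : Indecomp M) :
    Annihilates Λ S M ↔ NAnn Λ (dimV M) S := by
  induction S generalizing Λ with
  | nil => exact ⟨fun h => hM.1 h, fun h => h.elim⟩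
  | cons x S ih =>
    rcases refl_cases x Λ hS.1 M hM with ⟨h0, hd⟩ | ⟨hI, hs, hd, hne⟩
    · exact ⟨fun _ => Or.inl hd, fun _ => FList_zero _ S hS.2 _ h0⟩
    · have := ih _ hS.2 _ hI
      rw [nann_flipO, hd] at this
      exact ⟨fun h => Or.inr ⟨dimV_nonneg M, this.1 h⟩,
        fun h => this.2 ((h.resolve_left hne).2)⟩

theorem word_nonneg {k : Type} [Field k] {n : ℕ} (Λ : Fin n → Fin n → ℕ) (S : List (Fin n))
    (hS : Admissible Λ S) (M : Rep k n Λ) (hM : Indecomp M) (hA : ¬ NAnn Λ (dimV M) S) :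
    0 ≤ wordOfSeq Λ S (dimV M) := by
  induction S generalizing Λ with
  | nil => rw [wordOfSeq_nil]; exact dimV_nonneg M
  | cons x S ih =>
    rcases refl_cases x Λ hS.1 M hM with ⟨h0, hd⟩ | ⟨hI, hs, hd, hne⟩
    · exact (hA (Or.inl hd)).elim
    · have := ih _ hS.2 _ hI
      rw [nann_flipO, hd, wordOfSeq_flipO] at this
      rw [wordOfSeq_cons]
      exact this fun h => hA (Or.inr ⟨dimV_nonneg M, h⟩)

theorem word_neg {n : ℕ} (Λ : Fin n → Fin n → ℕ) (S : List (Fin n)) (d : Fin n → ℤ)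
    (hd : NAnn Λ d S) (H : ∀ R U, S = R ++ U → U ≠ [] → ¬ NAnn Λ d R) :
    ∃ y, wordOfSeq Λ S d = - Pi.single y 1 := by
  induction S generalizing d with
  | nil => exact hd.elim
  | cons x S ih =>
    rcases hd with hd | ⟨h0, hd⟩
    · by_cases hS : S = []
      · subst hS
        exact ⟨x, by rw [wordOfSeq_cons, wordOfSeq_nil, hd, wSig_single]⟩
      · exact (H [x] S rfl hS (Or.inl hd)).elim
    · rw [wordOfSeq_cons]
      refine ih _ hd fun R U hR hU hN => H (x :: R) U (by rw [hR]; rfl) hU (Or.inr ⟨h0, hN⟩)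

theorem iso_of_simple {k : Type} [Field k] {n : ℕ} (x : Fin n) (Λ : Fin n → Fin n → ℕ)
    (hx : IsSink Λ x) (M N : Rep k n Λ) (hM : dimV M = Pi.single x 1)
    (hN : dimV N = Pi.single x 1) : RepIso M N := by
  have hd : ∀ z, M.d z = N.d z := by
    intro z
    have := (congrFun hM z).trans (congrFun hN z).symm
    exact Int.natCast_inj.1 this
  refine ⟨fun z => castL k (hd z), fun a b i v => ?_⟩
  by_cases ha : a = x
  · subst ha
    rw [hx b] at i; exact i.elim0
  · have h0 : M.d a = 0 := by
      have := congrFun hM a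
      simpa [dimV, ha] using this
    have : v = 0 := by
      funext j
      rw [h0] at j; exact j.elim0
    rw [this]; simp

theorem iso_of_seq {k : Type} [Field k] {n : ℕ} (Λ : Fin n → Fin n → ℕ) (S : List (Fin n))
    (hS : Admissible Λ S) (M N : Rep k n Λ) (hM : Indecomp M) (hN : Indecomp N)
    (aM : NAnn Λ (dimV M) S) (aN : NAnn Λ (dimV N) S)
    (HM : ∀ R U, S = R ++ U → U ≠ [] → ¬ NAnn Λ (dimV M) R)
    (HN : ∀ R U, S = R ++ U → U ≠ [] → ¬ NAnn Λ (dimV N) R) : RepIso M N := by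
  induction S generalizing Λ with
  | nil => exact aM.elim
  | cons x S ih =>
    by_cases hS0 : S = []
    · subst hS0
      have h1 : dimV M = Pi.single x 1 := by
        rcases aM with h | h
        · exact h
        · exact h.2.elim
      have h2 : dimV N = Pi.single x 1 := by
        rcases aN with h | h
        · exact h
        · exact h.2.elim
      exact iso_of_simple x Λ hS.1 M N h1 h2
    · have n1 : dimV M ≠ Pi.single x 1 := fun h => HM [x] S rfl hS0 (Or.inl h)
      have n2 : dimV N ≠ Pi.single x 1 := fun h => HN [x] S rfl hS0 (Or.inl h)
      rcases refl_cases x Λ hS.1 M hM with ⟨_, hd⟩ | ⟨hI, hs, hd, _⟩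
      · exact (n1 hd).elim
      rcases refl_cases x Λ hS.1 N hN with ⟨_, hd'⟩ | ⟨hI', hs', hd', _⟩
      · exact (n2 hd').elim
      refine refRel_unique x Λ hS.1 M N _ _ (refRel_reflPlus x Λ (hS.1 x) M)
        (refRel_reflPlus x Λ (hS.1 x) N) hs hs' (ih _ hS.2 _ _ hI hI' ?_ ?_ ?_ ?_)
      · rw [nann_flipO, hd]; exact (aM.resolve_left n1).2
      · rw [nann_flipO, hd']; exact (aN.resolve_left n2).2
      · intro R U hR hU hA
        rw [nann_flipO, hd] at hA
        exact HM (x :: R) U (by rw [hR]; rfl) hU (Or.inr ⟨dimV_nonneg M, hA⟩)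
      · intro R U hR hU hA
        rw [nann_flipO, hd'] at hA
        exact HN (x :: R) U (by rw [hR]; rfl) hU (Or.inr ⟨dimV_nonneg N, hA⟩)

theorem shortest_prefix {k : Type} [Field k] {n : ℕ} (Λ : Fin n → Fin n → ℕ) (M : Rep k n Λ)
    (hM : Indecomp M) (S R U : List (Fin n)) (hS : IsShortestAnn Λ M S)
    (hR : Sim (edges Λ) S (R ++ U)) (hA : NAnn Λ (dimV M) R) :
    U = [] ∧ Sim (edges Λ) R S := by
  obtain ⟨h1, h2, h3⟩ := hS
  have ha := (adm_append Λ R U).1 (sim_adm Λ hR h1)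
  have hs := h3 R ha.1 ((ann_iff Λ R ha.1 M hM).2 hA) ⟨U, ha.2, hR⟩
  have l1 := sim_length hs
  have l2 := sim_length hR
  rw [List.length_append] at l2
  exact ⟨List.length_eq_zero_iff.1 (by omega), hs⟩

theorem shortest_le {k : Type} [Field k] {n : ℕ} (Λ : Fin n → Fin n → ℕ) (N : Rep k n Λ)
    (hN : Indecomp N) (S T : List (Fin n)) (hT : IsShortestAnn Λ N T) (hS : Admissible Λ S)
    (hA : NAnn Λ (dimV N) S) :
    T.length ≤ S.length ∧ (S.length ≤ T.length → Sim (edges Λ) S T) := by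
  obtain ⟨R, hR, ⟨U, hU⟩, V, hV⟩ := key_common Λ S T (dimV N) hS hT.1 hA
    ((ann_iff Λ T hT.1 N hN).1 hT.2.1)
  obtain ⟨rfl, hs⟩ := shortest_prefix Λ N hN T R V hT hV hR
  have l1 := sim_length hs
  have l2 := sim_length hU
  rw [List.length_append] at l2
  refine ⟨by omega, fun h => ?_⟩
  have : U = [] := List.length_eq_zero_iff.1 (by omega)
  subst this
  rw [List.append_nil] at hU
  exact sim_trans hU hs

theorem kills_of_word {k : Type} [Field k] {n : ℕ} (Λ : Fin n → Fin n → ℕ) (N : Rep k n Λ)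
    (hN : Indecomp N) (S T : List (Fin n)) (hT : IsShortestAnn Λ N T) (hS : Admissible Λ S)
    (hw : wordOfSeq Λ S = wordOfSeq Λ T) : NAnn Λ (dimV N) S := by
  by_contra hA
  have h1 := word_nonneg Λ S hS N hN hA
  obtain ⟨y, hy⟩ := word_neg Λ T (dimV N) ((ann_iff Λ T hT.1 N hN).1 hT.2.1)
    (fun R U hR hU hA' => hU (shortest_prefix Λ N hN T R U hT (hR ▸ sim_refl _ _) hA').1)
  rw [hw, hy] at h1
  have := h1 y
  simp at this

end Final

theorem indecomposable_iso_iff_word_eq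
    (n : ℕ) (hn : 2 ≤ n) (Λ : Fin n → Fin n → ℕ)
    (hloop : ∀ a, Λ a a = 0)
    (hconn : ∀ a b : Fin n, Relation.ReflTransGen (fun u v => edges Λ u v ≠ 0) a b)
    (hacyc : ∀ a : Fin n, ¬ Relation.TransGen (fun u v => Λ u v ≠ 0) a a)
    (k : Type) [Field k]
    (M N : Rep k n Λ) (hMi : Indecomp M) (hNi : Indecomp N)
    (hMp : Preprojective Λ M) (hNp : Preprojective Λ N)
    (SM SN : List (Fin n)) (hSM : IsShortestAnn Λ M SM) (hSN : IsShortestAnn Λ N SN) :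
    (RepIso M N ↔ Sim (edges Λ) SM SN) ∧
    (Sim (edges Λ) SM SN ↔ wordOfSeq Λ SM = wordOfSeq Λ SN) := by
  have aM := (ann_iff Λ SM hSM.1 M hMi).1 hSM.2.1
  have aN := (ann_iff Λ SN hSN.1 N hNi).1 hSN.2.1
  have both : NAnn Λ (dimV N) SM → NAnn Λ (dimV M) SN → Sim (edges Λ) SM SN := fun h1 h2 =>
    (shortest_le Λ N hNi SM SN hSN hSM.1 h1).2 (shortest_le Λ M hMi SN SM hSM hSN.1 h2).1
  refine ⟨⟨fun h => ?_, fun h => ?_⟩, ⟨fun h => sim_word Λ h, fun h => ?_⟩⟩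
  · have hd : dimV M = dimV N := by
      funext z
      simp only [dimV, repIso_dim h]
    exact both (hd ▸ aM) (hd.symm ▸ aN)
  · refine iso_of_seq Λ SM hSM.1 M N hMi hNi aM (sim_nann Λ (sim_symm Λ h) _ aN) ?_ ?_
    · intro R U hR hU hA
      exact hU (shortest_prefix Λ M hMi SM R U hSM (hR ▸ sim_refl _ _) hA).1
    · intro R U hR hU hA
      exact hU (shortest_prefix Λ N hNi SN R U hSN (hR ▸ sim_symm Λ h) hA).1
  · exact both (kills_of_word Λ N hNi SM SN hSN hSM.1 h)
      (kills_of_word Λ M hMi SN SM hSM hSN.1 h.symm)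

end KP
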